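/- arXiv:math/0601433 — 2 statements merged into one kernel-verified Lean document; each statement's English description precedes it below -/
import Mathlib

section
/- Let n ≥ 2 and let X : ℝⁿ → ℝⁿ be a C¹, ℤⁿ-periodic, divergence-free vector field. Then for every ε > 0 there exists a C^∞, ℤⁿ-periodic, divergence-free vector field Z : ℝⁿ → ℝⁿ such that sup_{x ∈ ℝⁿ} (‖X(x) − Z(x)‖ + ‖DX(x) − DZ(x)‖_op) < ε. (This is the torus formulation of the theorem that C^∞ divergence-free vector fields are C¹-dense among C¹ divergence-free vector fields on a compact boundaryless manifold.) -/
noncomputable section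

/-- Divergence-free: the trace of the total derivative vanishes everywhere. -/
def DivFree {n : ℕ} (X : EuclideanSpace ℝ (Fin n) → EuclideanSpace ℝ (Fin n)) : Prop :=
  ∀ x, LinearMap.trace ℝ (EuclideanSpace ℝ (Fin n)) (fderiv ℝ X x).toLinearMap = 0

/-- ℤⁿ-periodicity. -/
def ZnPeriodic {n : ℕ} (X : EuclideanSpace ℝ (Fin n) → EuclideanSpace ℝ (Fin n)) : Prop :=
  ∀ (x : EuclideanSpace ℝ (Fin n)) (m : Fin n → ℤ),
    X (x + (WithLp.equiv 2 (Fin n → ℝ)).symm (fun i => (m i : ℝ))) = X x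

open MeasureTheory
open scoped Convolution

/-- The integer lattice vector with coordinates `m`. -/
def latticeVector {n : ℕ} (m : Fin n → ℤ) : EuclideanSpace ℝ (Fin n) :=
  (WithLp.equiv 2 (Fin n → ℝ)).symm (fun i => (m i : ℝ))

lemma norm_add_latticeVector_neg_floor_le {n : ℕ} (x : EuclideanSpace ℝ (Fin n)) :
    ‖x + latticeVector (fun i => -⌊x i⌋)‖ ≤ √n := by
  rw [EuclideanSpace.norm_eq]
  refine Real.sqrt_le_sqrt ?_
  calc ∑ i, ‖(x + latticeVector (fun i => -⌊x i⌋)) i‖ ^ 2 ≤ ∑ _i : Fin n, (1 : ℝ) := by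
        refine Finset.sum_le_sum fun i _ => ?_
        have h : (x + latticeVector (fun i => -⌊x i⌋)) i = Int.fract (x i) := by
          simp [latticeVector, Int.fract, sub_eq_add_neg]
        rw [h, Real.norm_of_nonneg (Int.fract_nonneg _)]
        exact pow_le_one₀ (Int.fract_nonneg _) (Int.fract_lt_one _).le
    _ = n := by simp

section Periodic

variable {n : ℕ} {F : Type*} [NormedAddCommGroup F] {f : EuclideanSpace ℝ (Fin n) → F}

lemma exists_norm_le_of_lattice_periodic (hf : Continuous f)
    (hper : ∀ x m, f (x + latticeVector m) = f x) : ∃ C, ∀ x, ‖f x‖ ≤ C := by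
  obtain ⟨C, hC⟩ := (isCompact_closedBall (0 : EuclideanSpace ℝ (Fin n))
    √n).exists_bound_of_continuousOn hf.continuousOn
  refine ⟨C, fun x => ?_⟩
  rw [← hper x (fun i => -⌊x i⌋)]
  exact hC _ (by simpa using norm_add_latticeVector_neg_floor_le x)

lemma uniformContinuous_of_lattice_periodic (hf : Continuous f)
    (hper : ∀ x m, f (x + latticeVector m) = f x) : UniformContinuous f := by
  rw [Metric.uniformContinuous_iff]
  intro ε hε
  obtain ⟨δ, hδ, h⟩ := Metric.mem_uniformity_dist.1
    ((isCompact_closedBall (0 : EuclideanSpace ℝ (Fin n)) √n).uniformContinuousAt_of_continuousAt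
      f (fun a _ => hf.continuousAt) (Metric.dist_mem_uniformity hε))
  refine ⟨δ, hδ, fun x y hxy => ?_⟩
  rw [← hper x (fun i => -⌊x i⌋), ← hper y (fun i => -⌊x i⌋)]
  exact h (by simpa using hxy) (by simpa using norm_add_latticeVector_neg_floor_le x)

end Periodic

lemma integrable_normed_smul_comp_sub {E F : Type*} [NormedAddCommGroup E] [NormedSpace ℝ E]
    [FiniteDimensional ℝ E] [MeasurableSpace E] [BorelSpace E] (μ : Measure E)
    [IsLocallyFiniteMeasure μ] [μ.IsOpenPosMeasure]
    [NormedAddCommGroup F] [NormedSpace ℝ F] (φ : ContDiffBump (0 : E))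
    {g : E → F} (hg : Continuous g) (x : E) :
    Integrable (fun t => φ.normed μ t • g (x - t)) μ :=
  (φ.continuous_normed.smul (by fun_prop)).integrable_of_hasCompactSupport
    φ.hasCompactSupport_normed.smul_right

lemma hasFDerivAt_normed_convolution {E F : Type*} [NormedAddCommGroup E] [NormedSpace ℝ E]
    [FiniteDimensional ℝ E] [MeasurableSpace E] [BorelSpace E] (μ : Measure E)
    [IsLocallyFiniteMeasure μ] [μ.IsOpenPosMeasure]
    [NormedAddCommGroup F] [NormedSpace ℝ F] (φ : ContDiffBump (0 : E))
    {g : E → F} (hg : ContDiff ℝ 1 g) {C : ℝ} (hC : ∀ x, ‖fderiv ℝ g x‖ ≤ C) (x : E) :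
    HasFDerivAt (φ.normed μ ⋆[ContinuousLinearMap.lsmul ℝ ℝ, μ] g)
      ((φ.normed μ ⋆[ContinuousLinearMap.lsmul ℝ ℝ, μ] fderiv ℝ g) x) x := by
  have hg' : Continuous (fderiv ℝ g) := hg.continuous_fderiv one_ne_zero
  refine hasFDerivAt_integral_of_dominated_of_fderiv_le (bound := fun t => φ.normed μ t * C)
    (F' := fun y t => φ.normed μ t • fderiv ℝ g (y - t)) Filter.univ_mem
    (.of_forall fun y => (integrable_normed_smul_comp_sub μ φ hg.continuous y).aestronglyMeasurable)
    (integrable_normed_smul_comp_sub μ φ hg.continuous x)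
    (integrable_normed_smul_comp_sub μ φ hg' x).aestronglyMeasurable
    (.of_forall fun t y _ => ?_) (φ.integrable_normed.mul_const C) (.of_forall fun t y _ => ?_)
  · rw [norm_smul, Real.norm_of_nonneg (φ.nonneg_normed t)]
    exact mul_le_mul_of_nonneg_left (hC _) (φ.nonneg_normed t)
  · have h := (hg.differentiable one_ne_zero (y - t)).hasFDerivAt.comp y
      ((hasFDerivAt_id y).sub_const t)
    exact h.const_smul (φ.normed μ t)

/-- C^∞ divergence-free vector fields are C¹-dense among C¹ divergence-free
vector fields on the torus (ℤⁿ-periodic formulation). -/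
theorem smooth_divergenceFree_C1_dense (n : ℕ) (hn : 2 ≤ n)
    (X : EuclideanSpace ℝ (Fin n) → EuclideanSpace ℝ (Fin n))
    (hX : ContDiff ℝ 1 X) (hXper : ZnPeriodic X) (hXdiv : DivFree X)
    (ε : ℝ) (hε : 0 < ε) :
    ∃ Z : EuclideanSpace ℝ (Fin n) → EuclideanSpace ℝ (Fin n),
      ContDiff ℝ (⊤ : ℕ∞) Z ∧ ZnPeriodic Z ∧ DivFree Z ∧
      ∀ x, ‖X x - Z x‖ + ‖fderiv ℝ X x - fderiv ℝ Z x‖ < ε := by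
  have hX' : Continuous (fderiv ℝ X) := hX.continuous_fderiv one_ne_zero
  have hX'per : ∀ x m, fderiv ℝ X (x + latticeVector m) = fderiv ℝ X x := fun x m => by
    rw [← fderiv_comp_add_right]
    exact congrArg (fderiv ℝ · x) (funext fun y => hXper y m)
  obtain ⟨C, hC⟩ := exists_norm_le_of_lattice_periodic hX' hX'per
  obtain ⟨δ₀, hδ₀, h₀⟩ := Metric.uniformContinuous_iff.1
    (uniformContinuous_of_lattice_periodic hX.continuous hXper) (ε / 3) (by positivity)
  obtain ⟨δ₁, hδ₁, h₁⟩ := Metric.uniformContinuous_iff.1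
    (uniformContinuous_of_lattice_periodic hX' hX'per) (ε / 3) (by positivity)
  have hδ : 0 < min δ₀ δ₁ := lt_min hδ₀ hδ₁
  let φ : ContDiffBump (0 : EuclideanSpace ℝ (Fin n)) :=
    ⟨min δ₀ δ₁ / 2, min δ₀ δ₁, half_pos hδ, half_lt_self hδ⟩
  have hderiv := hasFDerivAt_normed_convolution volume φ hX hC
  refine ⟨φ.normed volume ⋆[ContinuousLinearMap.lsmul ℝ ℝ, volume] X, ?_, ?_, ?_, ?_⟩
  · exact φ.hasCompactSupport_normed.contDiff_convolution_left _ φ.contDiff_normed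
      hX.continuous.locallyIntegrable
  · intro x m
    simp only [convolution_def]
    congr 1 with t : 1
    rw [add_sub_right_comm, hXper]
  · intro x
    rw [(hderiv x).fderiv]
    let T := LinearMap.toContinuousLinearMap ((LinearMap.trace ℝ (EuclideanSpace ℝ (Fin n))).comp
      (ContinuousLinearMap.coeLM ℝ))
    have hT : ∀ y, T (fderiv ℝ X y) = 0 := hXdiv
    change T (∫ t, φ.normed volume t • fderiv ℝ X (x - t)) = 0
    rw [← T.integral_comp_comm (integrable_normed_smul_comp_sub volume φ hX' x)]
    simp [hT]
  · intro x
    have e₀ := φ.dist_normed_convolution_le (μ := volume) (x₀ := x)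
      hX.continuous.aestronglyMeasurable
      fun y hy => (h₀ (lt_of_lt_of_le hy (min_le_left _ _))).le
    have e₁ := φ.dist_normed_convolution_le (μ := volume) (x₀ := x) hX'.aestronglyMeasurable
      fun y hy => (h₁ (lt_of_lt_of_le hy (min_le_right _ _))).le
    rw [dist_comm, dist_eq_norm] at e₀ e₁
    rw [(hderiv x).fderiv]
    linarith
end
end

section
/- (C^{1+α} Pasting Lemma for vector fields.) Let n ≥ 2 and α ∈ (0,1). Let K ⊂ ℝⁿ be compact and U a bounded open set with K ⊆ U. For every ε₀ > 0 there exist δ₀ > 0 and open sets V, W with K ⊆ V ⊆ U ⊆ W and W bounded, such that: for all divergence-free vector fields X₀, Y₀ : ℝⁿ → ℝⁿ of class C^{1+α} with sup_{x ∈ U} (‖X₀(x) − Y₀(x)‖ + ‖DX₀(x) − DY₀(x)‖_op) < δ₀, there exists a divergence-free vector field Z₀ : ℝⁿ → ℝⁿ of class C^{1+α} satisfying: Z₀ = Y₀ on V, Z₀ = X₀ on the complement of W, and sup_{x ∈ ℝⁿ} (‖Z₀(x) − X₀(x)‖ + ‖DZ₀(x) − DX₀(x)‖_op) < ε₀. Moreover,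 if X₀ and Y₀ are C^∞ then Z₀ can be chosen C^∞. -/
noncomputable section

/-- A map is of class C^{1+α}: it is C¹ and its derivative is α-Hölder. -/
def C1Holder {n : ℕ} (α : ℝ) (X : EuclideanSpace ℝ (Fin n) → EuclideanSpace ℝ (Fin n)) : Prop :=
  ContDiff ℝ 1 X ∧ ∃ C : ℝ, 0 ≤ C ∧ ∀ x y, ‖fderiv ℝ X x - fderiv ℝ X y‖ ≤ C * ‖x - y‖ ^ α

open Set Filter Topology MeasureTheory Function

section Holder

set_option linter.unusedSectionVars false

variable {E F G H : Type*} [NormedAddCommGroup E] [NormedSpace ℝ E]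
  [NormedAddCommGroup F] [NormedSpace ℝ F] [NormedAddCommGroup G] [NormedSpace ℝ G]
  [NormedAddCommGroup H] [NormedSpace ℝ H]

/-- `f` is bounded and `α`-Hölder on `s`. -/
def HolderBdd (α : ℝ) (s : Set E) (f : E → F) : Prop :=
  ∃ C : ℝ, 0 ≤ C ∧ (∀ x ∈ s, ‖f x‖ ≤ C) ∧ ∀ x ∈ s, ∀ y ∈ s, ‖f x - f y‖ ≤ C * ‖x - y‖ ^ α

theorem HolderBdd.mono {α : ℝ} {s t : Set E} {f : E → F} (hf : HolderBdd α t f) (h : s ⊆ t) :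
    HolderBdd α s f := by
  obtain ⟨C, hC, hb, hh⟩ := hf
  exact ⟨C, hC, fun x hx => hb x (h hx), fun x hx y hy => hh x (h hx) y (h hy)⟩

theorem HolderBdd.add {α : ℝ} {s : Set E} {f g : E → F} (hf : HolderBdd α s f)
    (hg : HolderBdd α s g) : HolderBdd α s (fun x => f x + g x) := by
  obtain ⟨C, hC, hfb, hfh⟩ := hf
  obtain ⟨D, hD, hgb, hgh⟩ := hg
  refine ⟨C + D, by positivity, fun x hx => (norm_add_le _ _).trans (add_le_add (hfb x hx) (hgb x hx)),
    fun x hx y hy => ?_⟩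
  calc ‖f x + g x - (f y + g y)‖ = ‖(f x - f y) + (g x - g y)‖ := by congr 1; abel
    _ ≤ C * ‖x - y‖ ^ α + D * ‖x - y‖ ^ α :=
        (norm_add_le _ _).trans (add_le_add (hfh x hx y hy) (hgh x hx y hy))
    _ = _ := by ring

theorem HolderBdd.bilin {α : ℝ} {s : Set E} {f : E → F} {g : E → G} (B : F →L[ℝ] G →L[ℝ] H)
    (hf : HolderBdd α s f) (hg : HolderBdd α s g) : HolderBdd α s (fun x => B (f x) (g x)) := by
  obtain ⟨C, hC, hfb, hfh⟩ := hf
  obtain ⟨D, hD, hgb, hgh⟩ := hg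
  refine ⟨2 * (‖B‖ * C * D), by positivity, fun x hx => ?_, fun x hx y hy => ?_⟩
  · calc ‖B (f x) (g x)‖ ≤ ‖B‖ * ‖f x‖ * ‖g x‖ := B.le_opNorm₂ _ _
      _ ≤ ‖B‖ * C * D := by gcongr; exacts [hfb x hx, hgb x hx]
      _ ≤ _ := by nlinarith [show 0 ≤ ‖B‖ * C * D by positivity]
  · have h1 : B (f x) (g x) - B (f y) (g y) = B (f x - f y) (g x) + B (f y) (g x - g y) := by
      simp only [map_sub, sub_apply]; abel
    rw [h1]
    calc ‖B (f x - f y) (g x) + B (f y) (g x - g y)‖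
        ≤ ‖B‖ * ‖f x - f y‖ * ‖g x‖ + ‖B‖ * ‖f y‖ * ‖g x - g y‖ :=
          (norm_add_le _ _).trans (add_le_add (B.le_opNorm₂ _ _) (B.le_opNorm₂ _ _))
      _ ≤ ‖B‖ * (C * ‖x - y‖ ^ α) * D + ‖B‖ * C * (D * ‖x - y‖ ^ α) := by
          gcongr
          exacts [hfh x hx y hy, hgb x hx, hfb y hy, hgh x hx y hy]
      _ = _ := by ring

theorem le_max_mul_rpow {α t a b : ℝ} (hα : α ∈ Ioo (0 : ℝ) 1) (ht : 0 ≤ t) (ha : 0 ≤ a)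
    (hb : 0 ≤ b) : min (a * t) b ≤ (a + b) * t ^ α := by
  have h0 : 0 ≤ t ^ α := Real.rpow_nonneg ht α
  rcases le_total t 1 with h | h
  · have : t ≤ t ^ α := by
      rcases ht.eq_or_lt with rfl | h'
      · exact h0
      · simpa using Real.rpow_le_rpow_of_exponent_ge h' h hα.2.le
    exact (min_le_left _ _).trans (by nlinarith [mul_le_mul_of_nonneg_left this ha, mul_nonneg hb h0])
  · have : 1 ≤ t ^ α := Real.one_le_rpow h hα.1.le
    exact (min_le_right _ _).trans (by nlinarith [mul_le_mul_of_nonneg_left this hb, mul_nonneg ha h0])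

theorem holderBdd_of_lipschitz {α : ℝ} (hα : α ∈ Ioo (0 : ℝ) 1) {s : Set E} {f : E → F} {C : ℝ}
    (hC : 0 ≤ C) (hb : ∀ x ∈ s, ‖f x‖ ≤ C) (hl : ∀ x ∈ s, ∀ y ∈ s, ‖f x - f y‖ ≤ C * ‖x - y‖) :
    HolderBdd α s f := by
  refine ⟨C + (C + C), by positivity, fun x hx => (hb x hx).trans (by linarith), fun x hx y hy => ?_⟩
  refine le_trans (le_min (hl x hx y hy) ?_)
    (le_max_mul_rpow hα (norm_nonneg (x - y)) hC (add_nonneg hC hC))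
  exact (norm_sub_le _ _).trans (add_le_add (hb x hx) (hb y hy))

theorem holderBdd_of_contDiff {α : ℝ} (hα : α ∈ Ioo (0 : ℝ) 1) {s : Set E} (hs : Convex ℝ s)
    {f : E → F} (hf : ContDiff ℝ 1 f) {C : ℝ} (hC : 0 ≤ C) (hb : ∀ x ∈ s, ‖f x‖ ≤ C)
    (hd : ∀ x ∈ s, ‖fderiv ℝ f x‖ ≤ C) : HolderBdd α s f :=
  holderBdd_of_lipschitz hα hC hb fun _ hx _ hy =>
    hs.norm_image_sub_le_of_norm_fderiv_le
      (fun _ _ => (hf.differentiable one_ne_zero).differentiableAt) hd hy hx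

/-- A Hölder function on a neighbourhood of its support is globally Hölder. -/
theorem HolderBdd.univ_of_eq_zero {α : ℝ} (hα : α ∈ Ioo (0 : ℝ) 1) {R : ℝ} {f : E → F}
    (hf : HolderBdd α (Metric.closedBall 0 (R + 1)) f) (h0 : ∀ x, R < ‖x‖ → f x = 0) :
    HolderBdd α univ f := by
  obtain ⟨C, hC, hb, hh⟩ := hf
  have hb' : ∀ x, ‖f x‖ ≤ C := fun x => by
    by_cases hx : ‖x‖ ≤ R
    · exact hb x (by simpa using hx.trans (by linarith))
    · rw [h0 x (not_le.1 hx)]; simpa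
  have key : ∀ x y, R + 1 < ‖x‖ → ‖f x - f y‖ ≤ C * ‖x - y‖ ^ α := fun x y hx => by
    rw [h0 x (by linarith)]
    by_cases hy : ‖y‖ ≤ R
    · have h1 : 1 ≤ ‖x - y‖ := by have := norm_sub_norm_le x y; linarith
      have h2 : 1 ≤ ‖x - y‖ ^ α := Real.one_le_rpow h1 hα.1.le
      rw [zero_sub, norm_neg]
      exact (hb' y).trans (by nlinarith)
    · rw [h0 y (not_le.1 hy)]; simp; positivity
  refine ⟨C, hC, fun x _ => hb' x, fun x _ y _ => ?_⟩
  by_cases hx : R + 1 < ‖x‖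
  · exact key x y hx
  by_cases hy : R + 1 < ‖y‖
  · rw [norm_sub_rev, norm_sub_rev x]; exact key y x hy
  · exact hh x (by simpa using hx) y (by simpa using hy)

theorem HolderBdd.fderiv_bilin {α : ℝ} {s : Set E} {f : E → F} {g : E → G}
    (B : F →L[ℝ] G →L[ℝ] H) (hfd : Differentiable ℝ f) (hgd : Differentiable ℝ g)
    (hf : HolderBdd α s f) (hg : HolderBdd α s g)
    (hf' : HolderBdd α s (fderiv ℝ f)) (hg' : HolderBdd α s (fderiv ℝ g)) :
    HolderBdd α s (fderiv ℝ fun x => B (f x) (g x)) := by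
  have : (fderiv ℝ fun x => B (f x) (g x)) = fun x =>
      B.precompR E (f x) (fderiv ℝ g x) + B.precompL E (fderiv ℝ f x) (g x) :=
    funext fun x => B.fderiv_of_bilinear (hfd x) (hgd x)
  rw [this]
  exact (hf.bilin _ hg').add (hf'.bilin _ hg)

/-- `f` is `C^{1+α}` with `C¹` norm at most `M`. -/
structure C1Bound (α M : ℝ) (f : E → F) : Prop where
  contDiff : ContDiff ℝ 1 f
  norm_le : ∀ x, ‖f x‖ ≤ M
  norm_fderiv_le : ∀ x, ‖fderiv ℝ f x‖ ≤ M
  holder : HolderBdd α univ (fderiv ℝ f)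

namespace C1Bound

variable {α M N : ℝ} {f g : E → F}

theorem differentiable (hf : C1Bound α M f) : Differentiable ℝ f :=
  hf.contDiff.differentiable one_ne_zero

theorem nonneg (hf : C1Bound α M f) : 0 ≤ M := (norm_nonneg _).trans (hf.norm_le 0)

theorem mono (hf : C1Bound α M f) (h : M ≤ N) : C1Bound α N f :=
  ⟨hf.contDiff, fun x => (hf.norm_le x).trans h, fun x => (hf.norm_fderiv_le x).trans h, hf.holder⟩

theorem holderBdd (hα : α ∈ Ioo (0 : ℝ) 1) (hf : C1Bound α M f) : HolderBdd α univ f :=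
  holderBdd_of_contDiff hα convex_univ hf.contDiff hf.nonneg (fun x _ => hf.norm_le x)
    (fun x _ => hf.norm_fderiv_le x)

theorem add (hf : C1Bound α M f) (hg : C1Bound α N g) : C1Bound α (M + N) (fun x => f x + g x) := by
  have h : fderiv ℝ (fun x => f x + g x) = fun x => fderiv ℝ f x + fderiv ℝ g x :=
    funext fun x => fderiv_fun_add (hf.differentiable x) (hg.differentiable x)
  refine ⟨hf.contDiff.add hg.contDiff,
    fun x => (norm_add_le _ _).trans (add_le_add (hf.norm_le x) (hg.norm_le x)), fun x => ?_, ?_⟩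
  · rw [h]
    exact (norm_add_le _ _).trans (add_le_add (hf.norm_fderiv_le x) (hg.norm_fderiv_le x))
  · rw [h]; exact hf.holder.add hg.holder

theorem zero : C1Bound α 0 (fun _ : E => (0 : F)) := by
  refine ⟨contDiff_const, by simp, by simp, 0, le_rfl, by simp, by simp⟩

theorem sum {ι : Type*} (s : Finset ι) {f : ι → E → F} {M : ι → ℝ}
    (h : ∀ i ∈ s, C1Bound α (M i) (f i)) :
    C1Bound α (∑ i ∈ s, M i) (fun x => ∑ i ∈ s, f i x) := by
  classical
  induction s using Finset.induction_on with
  | empty => simpa using zero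
  | insert a s ha ih =>
    simp only [Finset.sum_insert ha]
    exact (h a (by simp)).add (ih fun i hi => h i (by simp [hi]))

set_option maxSynthPendingDepth 3 in
theorem bilin (hα : α ∈ Ioo (0 : ℝ) 1) {g : E → G} (B : F →L[ℝ] G →L[ℝ] H) (hf : C1Bound α N f)
    (hg : C1Bound α M g) : C1Bound α (2 * ‖B‖ * N * M) (fun x => B (f x) (g x)) := by
  have hN := hf.nonneg
  have hM := hg.nonneg
  have hc : 0 ≤ ‖B‖ * N * M := by positivity
  refine ⟨B.isBoundedBilinearMap.contDiff.comp (hf.contDiff.prodMk hg.contDiff), fun x => ?_,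
    fun x => ?_, HolderBdd.fderiv_bilin B hf.differentiable hg.differentiable (hf.holderBdd hα)
      (hg.holderBdd hα) hf.holder hg.holder⟩
  · calc ‖B (f x) (g x)‖ ≤ ‖B‖ * ‖f x‖ * ‖g x‖ := B.le_opNorm₂ _ _
      _ ≤ ‖B‖ * N * M := by gcongr; exacts [hf.norm_le x, hg.norm_le x]
      _ ≤ _ := by nlinarith
  · rw [B.fderiv_of_bilinear (hf.differentiable x) (hg.differentiable x)]
    calc _ ≤ ‖B.precompR E‖ * ‖f x‖ * ‖fderiv ℝ g x‖ + ‖B.precompL E‖ * ‖fderiv ℝ f x‖ * ‖g x‖ :=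
          (norm_add_le _ _).trans
            (add_le_add (ContinuousLinearMap.le_opNorm₂ _ _ _) (ContinuousLinearMap.le_opNorm₂ _ _ _))
      _ ≤ ‖B‖ * N * M + ‖B‖ * N * M := by
          gcongr
          exacts [B.norm_precompR_le E, hf.norm_le x, hg.norm_fderiv_le x, B.norm_precompL_le E,
            hf.norm_fderiv_le x, hg.norm_le x]
      _ = _ := by ring

theorem smul (hα : α ∈ Ioo (0 : ℝ) 1) {a : E → ℝ} (ha : C1Bound α N a) (hf : C1Bound α M f) :
    C1Bound α (2 * N * M) (fun x => a x • f x) := by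
  refine (bilin hα (ContinuousLinearMap.lsmul ℝ ℝ) ha hf).mono ?_
  have h1 : ‖(ContinuousLinearMap.lsmul ℝ ℝ : ℝ →L[ℝ] F →L[ℝ] F)‖ ≤ 1 :=
    ContinuousLinearMap.opNorm_lsmul_le
  have := mul_nonneg ha.nonneg hf.nonneg
  nlinarith

theorem clm_comp (L : F →L[ℝ] G) (hf : C1Bound α M f) :
    C1Bound α (‖L‖ * M) (fun x => L (f x)) := by
  have hM := hf.nonneg
  have h : fderiv ℝ (fun x => L (f x)) = fun x => L.comp (fderiv ℝ f x) :=
    funext fun x => (L.hasFDerivAt.comp x (hf.differentiable x).hasFDerivAt).fderiv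
  refine ⟨L.contDiff.comp hf.contDiff, fun x => (L.le_opNorm _).trans (by gcongr; exact hf.norm_le x),
    fun x => ?_, ?_⟩
  · rw [h]
    exact (L.opNorm_comp_le _).trans (by gcongr; exact hf.norm_fderiv_le x)
  · obtain ⟨C, hC, hb, hh⟩ := hf.holder
    rw [h]
    refine ⟨‖L‖ * C, by positivity, fun x hx => (L.opNorm_comp_le _).trans (by gcongr; exact hb x hx),
      fun x hx y hy => ?_⟩
    rw [← ContinuousLinearMap.comp_sub, mul_assoc]
    exact (L.opNorm_comp_le _).trans (by gcongr; exact hh x hx y hy)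

theorem const_smul (c : ℝ) (hf : C1Bound α M f) : C1Bound α (|c| * M) (fun x => c • f x) := by
  refine (hf.clm_comp (c • ContinuousLinearMap.id ℝ F)).mono ?_
  have h1 : ‖c • ContinuousLinearMap.id ℝ F‖ ≤ |c| := by
    rw [norm_smul, Real.norm_eq_abs]
    exact mul_le_of_le_one_right (abs_nonneg c) ContinuousLinearMap.norm_id_le
  exact mul_le_mul_of_nonneg_right h1 hf.nonneg

theorem sub (hf : C1Bound α M f) (hg : C1Bound α N g) : C1Bound α (M + N) (fun x => f x - g x) := by
  simpa [sub_eq_add_neg] using hf.add (hg.const_smul (-1))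

end C1Bound

theorem HasCompactSupport.exists_c1Bound {α : ℝ} (hα : α ∈ Ioo (0 : ℝ) 1) {f : E → F}
    (hc : HasCompactSupport f) (hf : ContDiff ℝ 2 f) : ∃ N, C1Bound α N f := by
  have hf' : ContDiff ℝ 1 (fderiv ℝ f) := hf.fderiv_right (by norm_num)
  obtain ⟨A, hA⟩ := hf.continuous.bounded_above_of_compact_support hc
  obtain ⟨B, hB⟩ := hf'.continuous.bounded_above_of_compact_support (hc.fderiv ℝ)
  obtain ⟨C, hC⟩ := (hf'.continuous_fderiv one_ne_zero).bounded_above_of_compact_support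
    ((hc.fderiv ℝ).fderiv ℝ)
  refine ⟨max A B, hf.of_le (by norm_num), fun x => (hA x).trans (le_max_left _ _),
    fun x => (hB x).trans (le_max_right _ _), ?_⟩
  exact holderBdd_of_contDiff hα convex_univ hf' (C := max B C)
    ((norm_nonneg _).trans ((hB 0).trans (le_max_left _ _)))
    (fun x _ => (hB x).trans (le_max_left _ _)) (fun x _ => (hC x).trans (le_max_right _ _))

/-- A product with a compactly supported factor only sees the `C¹` size of the other factor on
the support. -/
theorem C1Bound.smul_of_tsupport [ProperSpace E] {α : ℝ} (hα : α ∈ Ioo (0 : ℝ) 1) {a : E → ℝ}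
    {f : E → F} {N M : ℝ} (ha : C1Bound α N a) (hc : HasCompactSupport a) (hf : ContDiff ℝ 1 f)
    {C : ℝ} (hh : ∀ x y, ‖fderiv ℝ f x - fderiv ℝ f y‖ ≤ C * ‖x - y‖ ^ α)
    (hM : 0 ≤ M) (hfM : ∀ x ∈ tsupport a, ‖f x‖ ≤ M)
    (hfM' : ∀ x ∈ tsupport a, ‖fderiv ℝ f x‖ ≤ M) :
    C1Bound α (2 * N * M) (fun x => a x • f x) := by
  have hN := ha.nonneg
  have hfd : Differentiable ℝ f := hf.differentiable one_ne_zero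
  have hd : ∀ x, fderiv ℝ (fun y => a y • f y) x
      = a x • fderiv ℝ f x + (fderiv ℝ a x).smulRight (f x) := fun x =>
    fderiv_fun_smul (ha.differentiable x) (hfd x)
  have hout : ∀ x ∉ tsupport a, a x = 0 ∧ fderiv ℝ a x = 0 := fun x hx =>
    ⟨image_eq_zero_of_notMem_tsupport hx, fderiv_of_notMem_tsupport ℝ hx⟩
  refine ⟨ha.contDiff.smul hf, fun x => ?_, fun x => ?_, ?_⟩
  · by_cases hx : x ∈ tsupport a
    · rw [norm_smul]
      have := mul_le_mul (ha.norm_le x) (hfM x hx) (norm_nonneg _) hN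
      nlinarith [mul_nonneg hN hM]
    · simp [(hout x hx).1]; positivity
  · rw [hd]
    by_cases hx : x ∈ tsupport a
    · refine (norm_add_le _ _).trans ?_
      rw [norm_smul, ContinuousLinearMap.norm_smulRight_apply]
      have h1 := mul_le_mul (ha.norm_le x) (hfM' x hx) (norm_nonneg _) hN
      have h2 := mul_le_mul (ha.norm_fderiv_le x) (hfM x hx) (norm_nonneg _) hN
      linarith
    · simp [(hout x hx).1, (hout x hx).2]; positivity
  · obtain ⟨R, hR⟩ := (isBounded_iff_forall_norm_le.1 hc.isCompact.isBounded)
    have hcomp := isCompact_closedBall (0 : E) (R + 1)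
    obtain ⟨A, hA⟩ := hcomp.exists_bound_of_continuousOn hf.continuous.continuousOn
    obtain ⟨B, hB⟩ := hcomp.exists_bound_of_continuousOn
      (hf.continuous_fderiv one_ne_zero).continuousOn
    set D := max (max A B) (max C 0) with hD
    have hCD : C ≤ D := (le_max_left _ _).trans (le_max_right _ _)
    have hBD : B ≤ D := (le_max_right _ _).trans (le_max_left _ _)
    have hAD : A ≤ D := (le_max_left _ _).trans (le_max_left _ _)
    have hD0 : 0 ≤ D := (le_max_right _ _).trans (le_max_right _ _)
    refine HolderBdd.univ_of_eq_zero hα (R := R) ?_ fun x hx => ?_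
    · refine HolderBdd.fderiv_bilin (ContinuousLinearMap.lsmul ℝ ℝ : ℝ →L[ℝ] F →L[ℝ] F)
        ha.differentiable hfd ?_ ?_ ?_ ?_
      · exact (ha.holderBdd hα).mono (subset_univ _)
      · exact holderBdd_of_contDiff hα (convex_closedBall _ _) hf hD0
          (fun x hx => (hA x hx).trans hAD) (fun x hx => (hB x hx).trans hBD)
      · exact ha.holder.mono (subset_univ _)
      · exact ⟨D, hD0, fun x hx => (hB x hx).trans hBD,
          fun x _ y _ => (hh x y).trans (by gcongr)⟩
    · have hx' : x ∉ tsupport a := fun h => absurd (hR x h) (not_le.2 hx)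
      rw [hd, (hout x hx').1, (hout x hx').2]
      simp

end Holder
section LineIntegral

set_option linter.unusedSectionVars false

universe u

variable {E F : Type u} [NormedAddCommGroup E] [NormedSpace ℝ E]
  [NormedAddCommGroup F] [NormedSpace ℝ F]

/-- The integral of `f` along the segment from `x + a • e` to `x + b • e`. -/
def lineInt (a b : ℝ) (e : E) (f : E → F) (x : E) : F := ∫ t in a..b, f (x + t • e)

theorem continuous_comp_line {f : E → F} (hf : Continuous f) (x e : E) :
    Continuous fun t : ℝ => f (x + t • e) := by fun_prop

theorem hasFDerivAt_lineInt {a b M : ℝ} {e : E} {f : E → F} (hf : ContDiff ℝ 1 f)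
    (hb : ∀ x, ‖fderiv ℝ f x‖ ≤ M) (x : E) :
    HasFDerivAt (lineInt a b e f) (lineInt a b e (fderiv ℝ f) x) x := by
  have hf' := hf.continuous_fderiv one_ne_zero
  refine intervalIntegral.hasFDerivAt_integral_of_dominated_of_fderiv_le (bound := fun _ => M)
    (s := univ) (F := fun x t => f (x + t • e)) (F' := fun x t => fderiv ℝ f (x + t • e))
    univ_mem ?_ ?_ ?_ ?_ ?_ ?_
  · exact Eventually.of_forall fun y =>
      (continuous_comp_line hf.continuous y e).aestronglyMeasurable
  · exact (continuous_comp_line hf.continuous x e).intervalIntegrable _ _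
  · exact (continuous_comp_line hf' x e).aestronglyMeasurable
  · exact Eventually.of_forall fun t _ y _ => hb _
  · exact intervalIntegrable_const
  · refine Eventually.of_forall fun t _ y _ => ?_
    have := ((hf.differentiable one_ne_zero) (y + t • e)).hasFDerivAt
    simpa [Function.comp_def] using this.comp y ((hasFDerivAt_id y).add_const (t • e))

theorem fderiv_lineInt {a b M : ℝ} {e : E} {f : E → F} (hf : ContDiff ℝ 1 f)
    (hb : ∀ x, ‖fderiv ℝ f x‖ ≤ M) :
    fderiv ℝ (lineInt a b e f) = lineInt a b e (fderiv ℝ f) :=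
  funext fun x => (hasFDerivAt_lineInt hf hb x).fderiv

theorem fderiv_lineInt_apply [CompleteSpace F] {a b M : ℝ} {e : E} {f : E → F}
    (hf : ContDiff ℝ 1 f) (hb : ∀ x, ‖fderiv ℝ f x‖ ≤ M) (x : E) :
    fderiv ℝ (lineInt a b e f) x e = f (x + b • e) - f (x + a • e) := by
  have hf' := hf.continuous_fderiv one_ne_zero
  rw [fderiv_lineInt hf hb, lineInt,
    ContinuousLinearMap.intervalIntegral_apply
      ((continuous_comp_line hf' x e).intervalIntegrable _ _)]
  refine intervalIntegral.integral_eq_sub_of_hasDerivAt (f := fun t : ℝ => f (x + t • e))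
    (fun t _ => ?_) ?_
  · have h1 : HasDerivAt (fun t : ℝ => x + t • e) e t := by
      simpa using ((hasDerivAt_id t).smul_const e).const_add x
    exact ((hf.differentiable one_ne_zero) (x + t • e)).hasFDerivAt.comp_hasDerivAt t h1
  · exact ((continuous_comp_line hf' x e).clm_apply continuous_const).intervalIntegrable _ _

theorem norm_lineInt_le {a b C : ℝ} (hab : a ≤ b) {e : E} {f : E → F} (hf : ∀ x, ‖f x‖ ≤ C)
    (x : E) : ‖lineInt a b e f x‖ ≤ (b - a) * C := by
  have := intervalIntegral.norm_integral_le_of_norm_le_const (a := a) (b := b) (C := C)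
    (f := fun t => f (x + t • e)) fun t _ => hf _
  rwa [abs_of_nonneg (sub_nonneg.2 hab), mul_comm] at this

theorem continuous_lineInt {a b : ℝ} {e : E} {f : E → F} (hf : Continuous f) :
    Continuous (lineInt a b e f) :=
  intervalIntegral.continuous_parametric_intervalIntegral_of_continuous'
    (f := fun x t => f (x + t • e)) (by unfold Function.uncurry; fun_prop) a b

theorem C1Bound.lineInt {α M a b : ℝ} (hab : a ≤ b) {e : E} {f : E → F} (hf : C1Bound α M f) :
    C1Bound α ((b - a) * M) (lineInt a b e f) := by
  have hfd := fderiv_lineInt (a := a) (b := b) (e := e) hf.contDiff hf.norm_fderiv_le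
  have hf' := hf.contDiff.continuous_fderiv one_ne_zero
  refine ⟨?_, norm_lineInt_le hab hf.norm_le, fun x => ?_, ?_⟩
  · rw [contDiff_one_iff_fderiv, hfd]
    exact ⟨fun x => (hasFDerivAt_lineInt hf.contDiff hf.norm_fderiv_le x).differentiableAt,
      continuous_lineInt hf'⟩
  · rw [hfd]; exact norm_lineInt_le hab hf.norm_fderiv_le x
  · obtain ⟨C, hC, hb, hh⟩ := hf.holder
    have hab' := sub_nonneg.2 hab
    rw [hfd]
    refine ⟨(b - a) * C, by positivity, fun x _ => norm_lineInt_le hab (fun y => hb y trivial) x,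
      fun x _ y _ => ?_⟩
    unfold _root_.lineInt
    rw [← intervalIntegral.integral_sub ((continuous_comp_line hf' x e).intervalIntegrable _ _)
      ((continuous_comp_line hf' y e).intervalIntegrable _ _)]
    have := intervalIntegral.norm_integral_le_of_norm_le_const (a := a) (b := b)
      (C := C * ‖x - y‖ ^ α)
      (f := fun t => fderiv ℝ f (x + t • e) - fderiv ℝ f (y + t • e)) fun t _ => by
        simpa using hh (x + t • e) trivial (y + t • e) trivial
    rw [abs_of_nonneg hab'] at this
    linarith

theorem contDiff_lineInt_nat {a b : ℝ} {e : E} (m : ℕ) :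
    ∀ {F : Type u} [NormedAddCommGroup F] [NormedSpace ℝ F] {f : E → F},
      ContDiff ℝ m f → HasCompactSupport f → ContDiff ℝ m (lineInt a b e f) := by
  induction m with
  | zero =>
    intro F _ _ f hf _
    exact contDiff_zero.2 (continuous_lineInt (contDiff_zero.1 hf))
  | succ m ih =>
    intro F _ _ f hf hc
    have hf1 : ContDiff ℝ 1 f := hf.of_le (by norm_cast; omega)
    obtain ⟨M, hM⟩ := (hf1.continuous_fderiv one_ne_zero).bounded_above_of_compact_support
      (hc.fderiv ℝ)
    push_cast at hf ⊢
    rw [contDiff_succ_iff_fderiv] at hf ⊢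
    refine ⟨fun x => (hasFDerivAt_lineInt hf1 hM x).differentiableAt, by simp, ?_⟩
    rw [fderiv_lineInt hf1 hM]
    exact ih hf.2.2 (hc.fderiv ℝ)

theorem contDiff_lineInt {a b : ℝ} {e : E} {f : E → F} (hf : ContDiff ℝ (⊤ : ℕ∞) f)
    (hc : HasCompactSupport f) : ContDiff ℝ (⊤ : ℕ∞) (lineInt a b e f) :=
  contDiff_infty.2 fun m => contDiff_lineInt_nat m (contDiff_infty.1 hf m) hc

theorem lineInt_eq_zero {a b : ℝ} {e x : E} {f : E → F}
    (h : ∀ t ∈ uIcc a b, f (x + t • e) = 0) : lineInt a b e f x = 0 := by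
  unfold lineInt
  rw [intervalIntegral.integral_congr (g := fun _ => (0 : F)) h]
  simp

/-- Multiplication by a fixed smooth function is bounded on functions supported in a fixed
compact set. -/
theorem exists_c1Bound_mul [FiniteDimensional ℝ E] {α : ℝ} (hα : α ∈ Ioo (0 : ℝ) 1) {a : E → ℝ}
    (ha : ContDiff ℝ (⊤ : ℕ∞) a) {B : Set E} (hB : IsCompact B) :
    ∃ C, 0 ≤ C ∧ ∀ (M : ℝ) (h : E → ℝ), C1Bound α M h → support h ⊆ B →
      C1Bound α (C * M) (fun x => a x * h x) := by
  obtain ⟨B', hB', hBB'⟩ := exists_compact_superset hB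
  obtain ⟨χ, h1, h0, -⟩ := exists_contMDiffMap_one_nhds_of_subset_interior (n := (⊤ : ℕ∞))
    (modelWithCornersSelf ℝ E) hB.isClosed hBB'
  have hχ : ContDiff ℝ (⊤ : ℕ∞) χ := χ.contMDiff.contDiff
  have hc : HasCompactSupport (fun x => χ x * a x) :=
    HasCompactSupport.intro hB' fun x hx => by rw [h0 x hx, zero_mul]
  obtain ⟨N, hN⟩ := hc.exists_c1Bound hα (mod_cast contDiff_infty.1 (hχ.mul ha) 2)
  refine ⟨2 * N, by linarith [hN.nonneg], fun M h hh hs => ?_⟩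
  convert hN.smul hα hh using 2 with x
  by_cases hx : x ∈ B
  · rw [h1.self_of_nhdsSet x hx, one_mul, smul_eq_mul]
  · rw [notMem_support.1 fun h => hx (hs h)]; simp

end LineIntegral
section Divergence

variable {n : ℕ}

/-- The divergence of a vector field. -/
def divergence (v : EuclideanSpace ℝ (Fin n) → EuclideanSpace ℝ (Fin n))
    (x : EuclideanSpace ℝ (Fin n)) : ℝ :=
  LinearMap.trace ℝ (EuclideanSpace ℝ (Fin n)) (fderiv ℝ v x).toLinearMap

theorem divergence_add {v w : EuclideanSpace ℝ (Fin n) → EuclideanSpace ℝ (Fin n)}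
    (hv : Differentiable ℝ v) (hw : Differentiable ℝ w) (x : EuclideanSpace ℝ (Fin n)) :
    divergence (fun y => v y + w y) x = divergence v x + divergence w x := by
  simp [divergence, fderiv_fun_add (hv x) (hw x)]

theorem divergence_sub {v w : EuclideanSpace ℝ (Fin n) → EuclideanSpace ℝ (Fin n)}
    (hv : Differentiable ℝ v) (hw : Differentiable ℝ w) (x : EuclideanSpace ℝ (Fin n)) :
    divergence (fun y => v y - w y) x = divergence v x - divergence w x := by
  simp [divergence, fderiv_fun_sub (hv x) (hw x)]

theorem divergence_const_smul (c : ℝ) {v : EuclideanSpace ℝ (Fin n) → EuclideanSpace ℝ (Fin n)}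
    (hv : Differentiable ℝ v) (x : EuclideanSpace ℝ (Fin n)) :
    divergence (fun y => c • v y) x = c * divergence v x := by
  simp [divergence, fderiv_fun_const_smul (hv x)]

theorem divergence_sum {ι : Type*} (s : Finset ι)
    {v : ι → EuclideanSpace ℝ (Fin n) → EuclideanSpace ℝ (Fin n)}
    (hv : ∀ i ∈ s, Differentiable ℝ (v i)) (x : EuclideanSpace ℝ (Fin n)) :
    divergence (fun y => ∑ i ∈ s, v i y) x = ∑ i ∈ s, divergence (v i) x := by
  simp [divergence, fderiv_fun_sum (fun i hi => hv i hi x)]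

theorem divergence_smul {a : EuclideanSpace ℝ (Fin n) → ℝ}
    {v : EuclideanSpace ℝ (Fin n) → EuclideanSpace ℝ (Fin n)}
    (ha : Differentiable ℝ a) (hv : Differentiable ℝ v) (x : EuclideanSpace ℝ (Fin n)) :
    divergence (fun y => a y • v y) x = fderiv ℝ a x (v x) + a x * divergence v x := by
  have h : ((fderiv ℝ a x).smulRight (v x)).toLinearMap
      = (fderiv ℝ a x).toLinearMap.smulRight (v x) := rfl
  rw [divergence, fderiv_fun_smul (ha x) (hv x), ContinuousLinearMap.toLinearMap_add, map_add, h,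
    LinearMap.trace_smulRight]
  simp [divergence, add_comm]

theorem divergence_smul_const {a : EuclideanSpace ℝ (Fin n) → ℝ} (ha : Differentiable ℝ a)
    (e x : EuclideanSpace ℝ (Fin n)) : divergence (fun y => a y • e) x = fderiv ℝ a x e := by
  rw [divergence_smul ha (differentiable_const e)]
  simp [divergence]

theorem integral_fderiv_apply_eq_zero {f : EuclideanSpace ℝ (Fin n) → ℝ} (hf : ContDiff ℝ 1 f)
    (hc : HasCompactSupport f) (e : EuclideanSpace ℝ (Fin n)) : ∫ x, fderiv ℝ f x e = 0 := by
  have h1 : Integrable (fun x => fderiv ℝ f x e) :=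
    ((hf.continuous_fderiv one_ne_zero).clm_apply continuous_const).integrable_of_hasCompactSupport
      (hc.fderiv_apply ℝ e)
  have := integral_mul_fderiv_eq_neg_fderiv_mul_of_integrable (μ := volume) (f := fun _ => (1 : ℝ))
    (g := f) (v := e) (by simp) (by simpa using h1)
    (by simpa using hf.continuous.integrable_of_hasCompactSupport hc) (by simp)
    (fun x _ => hf.differentiable one_ne_zero x)
  simpa using this

theorem integral_divergence_eq_zero {v : EuclideanSpace ℝ (Fin n) → EuclideanSpace ℝ (Fin n)}
    (hv : ContDiff ℝ 1 v) (hc : HasCompactSupport v) : ∫ x, divergence v x = 0 := by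
  have hcomp : ∀ i, ContDiff ℝ 1 fun x => v x i := fun i =>
    (EuclideanSpace.proj (𝕜 := ℝ) i : EuclideanSpace ℝ (Fin n) →L[ℝ] ℝ).contDiff.comp hv
  have hci : ∀ i, HasCompactSupport fun x => v x i := fun i =>
    hc.comp_left (g := fun y : EuclideanSpace ℝ (Fin n) => y i) rfl
  have h : ∀ x, divergence v x
      = ∑ i, fderiv ℝ (fun y => v y i) x (EuclideanSpace.single i 1) := fun x => by
    rw [divergence, LinearMap.trace_eq_sum_inner _ (EuclideanSpace.basisFun (Fin n) ℝ)]
    refine Finset.sum_congr rfl fun i _ => ?_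
    have := ((EuclideanSpace.proj (𝕜 := ℝ) i : EuclideanSpace ℝ (Fin n) →L[ℝ] ℝ).hasFDerivAt.comp x
      (hv.differentiable one_ne_zero x).hasFDerivAt).fderiv
    simp only [Function.comp_def, PiLp.proj_apply] at this
    rw [this]
    simp [EuclideanSpace.inner_single_left]
  simp_rw [h]
  rw [integral_finsetSum]
  · exact Finset.sum_eq_zero fun i _ => integral_fderiv_apply_eq_zero (hcomp i) (hci i) _
  · exact fun i _ => (((hcomp i).continuous_fderiv one_ne_zero).clm_apply
      continuous_const).integrable_of_hasCompactSupport ((hci i).fderiv_apply ℝ _)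

end Divergence

section Box

variable {n : ℕ}

/-- The closed cube with centre `c` and half-side `r`. -/
def closedCube (c : EuclideanSpace ℝ (Fin n)) (r : ℝ) : Set (EuclideanSpace ℝ (Fin n)) :=
  {x | ∀ i, |x i - c i| ≤ r}

theorem isCompact_closedCube (c : EuclideanSpace ℝ (Fin n)) (r : ℝ) :
    IsCompact (closedCube c r) := by
  have h : closedCube c r = (EuclideanSpace.equiv (Fin n) ℝ).toHomeomorph ⁻¹'
      (univ.pi fun i => Metric.closedBall (c i) r) := by
    ext x
    simp [closedCube, Real.dist_eq, -Metric.mem_closedBall, Metric.mem_closedBall]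
  rw [h]
  exact (Homeomorph.isCompact_preimage _).2 (isCompact_univ_pi fun i => isCompact_closedBall _ _)

theorem hasCompactSupport_of_cube {F : Type*} [Zero F] {c : EuclideanSpace ℝ (Fin n)} {r : ℝ}
    {h : EuclideanSpace ℝ (Fin n) → F} (hs : support h ⊆ closedCube c r) : HasCompactSupport h :=
  HasCompactSupport.intro (isCompact_closedCube c r) fun _ hx => notMem_support.1 fun h => hx (hs h)

/-- In the `i`-th coordinate, `h` is a multiple of the profile `η`. -/
def HasProfile (η : ℝ → ℝ) (i : Fin n) (h : EuclideanSpace ℝ (Fin n) → ℝ) : Prop :=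
  ∀ x (s : ℝ), h (x + s • EuclideanSpace.single i 1) * η (x i) = h x * η (x i + s)

theorem add_smul_single_self (x : EuclideanSpace ℝ (Fin n)) (i : Fin n) (t : ℝ) :
    (x + t • EuclideanSpace.single i (1 : ℝ)) i = x i + t := by simp

theorem add_smul_single_of_ne (x : EuclideanSpace ℝ (Fin n)) {i j : Fin n} (h : j ≠ i) (t : ℝ) :
    (x + t • EuclideanSpace.single i (1 : ℝ)) j = x j := by simp [h]

/-- `θ` is a smooth step rising from `0` to `1` on `[c - r, c + r]`. -/
structure IsStep (θ : ℝ → ℝ) (c r : ℝ) : Prop where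
  contDiff : ContDiff ℝ (⊤ : ℕ∞) θ
  eq_zero : ∀ s ≤ c - r, θ s = 0
  eq_one : ∀ s, c + r ≤ s → θ s = 1

theorem exists_isStep (c : ℝ) {r : ℝ} (hr : 0 < r) : ∃ θ, IsStep θ c r := by
  refine ⟨fun s => Real.smoothTransition ((s - (c - r)) / (2 * r)), ?_, fun s hs => ?_,
    fun s hs => ?_⟩
  · exact Real.smoothTransition.contDiff.comp (by fun_prop)
  · exact Real.smoothTransition.zero_of_nonpos
      (div_nonpos_of_nonpos_of_nonneg (by linarith) (by linarith))
  · exact Real.smoothTransition.one_of_one_le ((one_le_div (by linarith)).2 (by linarith))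

namespace IsStep

variable {θ : ℝ → ℝ} {c r : ℝ}

theorem deriv_contDiff (h : IsStep θ c r) : ContDiff ℝ (⊤ : ℕ∞) (deriv θ) :=
  ((contDiff_infty_iff_deriv (𝕜 := ℝ)).1 h.contDiff).2

theorem deriv_eq_zero (h : IsStep θ c r) {s : ℝ} (hs : r < |s - c|) : deriv θ s = 0 := by
  rcases lt_abs.1 hs with hs | hs
  · have : θ =ᶠ[𝓝 s] fun _ => 1 := by
      filter_upwards [Ioi_mem_nhds (show c + r < s by linarith)] with t ht using h.eq_one t ht.le
    rw [this.deriv_eq]; simp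
  · have : θ =ᶠ[𝓝 s] fun _ => 0 := by
      filter_upwards [Iio_mem_nhds (show s < c - r by linarith)] with t ht using h.eq_zero t ht.le
    rw [this.deriv_eq]; simp

theorem exists_deriv_ne_zero (h : IsStep θ c r) : ∃ s, deriv θ s ≠ 0 := by
  by_contra! h0
  have := is_const_of_deriv_eq_zero (h.contDiff.differentiable (by simp)) h0 (c - r) (c + r)
  rw [h.eq_zero _ le_rfl, h.eq_one _ le_rfl] at this
  exact zero_ne_one this

end IsStep

theorem lineInt_support {a b r L : ℝ} (ha : -L ≤ a) (hab : a ≤ b) (hb : b ≤ L)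
    {c : EuclideanSpace ℝ (Fin n)} {k : Fin n} {h : EuclideanSpace ℝ (Fin n) → ℝ}
    (hs : support h ⊆ closedCube c r) :
    support (lineInt a b (EuclideanSpace.single k (1 : ℝ)) h) ⊆ closedCube c (r + L) := by
  intro x hx
  by_contra hx'
  refine hx (lineInt_eq_zero fun t ht => notMem_support.1 fun hmem => hx' fun j => ?_)
  rw [uIcc_of_le hab] at ht
  have hj := hs hmem j
  by_cases hjk : j = k
  · subst hjk
    rw [add_smul_single_self] at hj
    rw [abs_le] at hj ⊢
    constructor <;> linarith [ht.1, ht.2]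
  · rw [add_smul_single_of_ne x hjk] at hj
    linarith [ht.1, ht.2]

/-- One-dimensional integration in the `k`-th coordinate: a function supported in a cube is a
`k`-th partial derivative up to a function with prescribed profile in the `k`-th coordinate. -/
theorem exists_partial_primitive {α : ℝ} (hα : α ∈ Ioo (0 : ℝ) 1)
    (c : EuclideanSpace ℝ (Fin n)) {r : ℝ} (hr : 0 < r) {θ : Fin n → ℝ → ℝ}
    (hθ : ∀ i, IsStep (θ i) (c i) r) (k : Fin n) :
    ∃ C, 0 ≤ C ∧ ∀ (M : ℝ) (h : EuclideanSpace ℝ (Fin n) → ℝ), C1Bound α M h →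
      support h ⊆ closedCube c r → ∃ u p : EuclideanSpace ℝ (Fin n) → ℝ,
        C1Bound α (C * M) u ∧ C1Bound α (C * M) p ∧
        support u ⊆ closedCube c r ∧ support p ⊆ closedCube c r ∧
        (∀ x, fderiv ℝ u x (EuclideanSpace.single k 1) = h x - p x) ∧
        (ContDiff ℝ (⊤ : ℕ∞) h → ContDiff ℝ (⊤ : ℕ∞) u ∧ ContDiff ℝ (⊤ : ℕ∞) p) ∧
        HasProfile (deriv (θ k)) k p ∧
        ∀ i ≠ k, HasProfile (deriv (θ i)) i h → HasProfile (deriv (θ i)) i p := by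
  set e : EuclideanSpace ℝ (Fin n) := EuclideanSpace.single k 1 with he
  set L := 3 * r with hL
  have hcoord : ContDiff ℝ (⊤ : ℕ∞) (fun x : EuclideanSpace ℝ (Fin n) => x k) :=
    (EuclideanSpace.proj (𝕜 := ℝ) k : EuclideanSpace ℝ (Fin n) →L[ℝ] ℝ).contDiff
  have hΘ : ContDiff ℝ (⊤ : ℕ∞) (fun x : EuclideanSpace ℝ (Fin n) => θ k (x k)) :=
    (hθ k).contDiff.comp hcoord
  have hη : ContDiff ℝ (⊤ : ℕ∞) (fun x : EuclideanSpace ℝ (Fin n) => deriv (θ k) (x k)) :=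
    (hθ k).deriv_contDiff.comp hcoord
  have hB := isCompact_closedCube c (r + L)
  obtain ⟨C₁, hC₁, hm₁⟩ := exists_c1Bound_mul hα (contDiff_const (c := (1 : ℝ)).sub hΘ) hB
  obtain ⟨C₂, hC₂, hm₂⟩ := exists_c1Bound_mul hα hΘ hB
  obtain ⟨C₃, hC₃, hm₃⟩ := exists_c1Bound_mul hα hη hB
  refine ⟨(C₁ + C₂ + C₃ * 2) * L, by positivity, fun M h hh hs => ?_⟩
  have hM := hh.nonneg
  have hL0 : 0 < L := by positivity
  have hzero : ∀ x i, r < |x i - c i| → h x = 0 := fun x i hx =>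
    notMem_support.1 fun hm => absurd (hs hm i) (not_le.2 hx)
  set P := lineInt (-L) 0 e h with hP
  set Q := lineInt 0 L e h with hQ
  have hPb : C1Bound α (L * M) P := by simpa using hh.lineInt (e := e) (show -L ≤ 0 by linarith)
  have hQb : C1Bound α (L * M) Q := by simpa using hh.lineInt (e := e) hL0.le
  have hPs : support P ⊆ closedCube c (r + L) := lineInt_support le_rfl (by linarith) hL0.le hs
  have hQs : support Q ⊆ closedCube c (r + L) := lineInt_support (by linarith) hL0.le le_rfl hs
  have hoff : ∀ x j, j ≠ k → r < |x j - c j| → P x = 0 ∧ Q x = 0 := fun x j hj hx => by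
    constructor <;> refine lineInt_eq_zero fun t _ => hzero _ j ?_ <;>
      rwa [he, add_smul_single_of_ne x hj]
  have hPQ : ∀ x, P x + Q x = lineInt (-L) L e h x := fun x =>
    intervalIntegral.integral_add_adjacent_intervals
      ((continuous_comp_line hh.contDiff.continuous x e).intervalIntegrable _ _)
      ((continuous_comp_line hh.contDiff.continuous x e).intervalIntegrable _ _)
  refine ⟨fun x => (1 - θ k (x k)) * P x - θ k (x k) * Q x,
    fun x => deriv (θ k) (x k) * P x + deriv (θ k) (x k) * Q x, ?_, ?_, ?_, ?_, ?_, ?_, ?_, ?_⟩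
  · refine ((hm₁ _ _ hPb hPs).sub (hm₂ _ _ hQb hQs)).mono ?_
    have : 0 ≤ C₃ * 2 * L * M := by positivity
    nlinarith
  · refine ((hm₃ _ _ hPb hPs).add (hm₃ _ _ hQb hQs)).mono ?_
    have : 0 ≤ (C₁ + C₂) * L * M := by positivity
    nlinarith
  · intro x hx j
    by_contra! hj
    refine hx ?_
    by_cases hjk : j = k
    · subst hjk
      rcases lt_abs.1 hj with h' | h'
      · have hQ0 : Q x = 0 := lineInt_eq_zero fun t ht => hzero _ j (by
          rw [uIcc_of_le hL0.le] at ht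
          rw [he, add_smul_single_self]
          exact lt_abs.2 (Or.inl (by linarith [ht.1])))
        simp [hQ0, (hθ j).eq_one (x j) (by linarith)]
      · have hP0 : P x = 0 := lineInt_eq_zero fun t ht => hzero _ j (by
          rw [uIcc_of_le (by linarith)] at ht
          rw [he, add_smul_single_self]
          exact lt_abs.2 (Or.inr (by linarith [ht.2])))
        simp [hP0, (hθ j).eq_zero (x j) (by linarith)]
    · simp [(hoff x j hjk hj).1, (hoff x j hjk hj).2]
  · intro x hx j
    by_contra! hj
    refine hx ?_
    by_cases hjk : j = k
    · subst hjk; simp [(hθ j).deriv_eq_zero hj]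
    · simp [(hoff x j hjk hj).1, (hoff x j hjk hj).2]
  · intro x
    have hΘ' : HasFDerivAt (fun x : EuclideanSpace ℝ (Fin n) => θ k (x k))
        (deriv (θ k) (x k) • (EuclideanSpace.proj k : EuclideanSpace ℝ (Fin n) →L[ℝ] ℝ)) x :=
      ((hθ k).contDiff.differentiable (by simp) (x k)).hasDerivAt.comp_hasFDerivAt x
        (EuclideanSpace.proj (𝕜 := ℝ) k : EuclideanSpace ℝ (Fin n) →L[ℝ] ℝ).hasFDerivAt
    have hP' := fderiv_lineInt_apply (a := -L) (b := 0) (e := e) hh.contDiff hh.norm_fderiv_le x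
    have hQ' := fderiv_lineInt_apply (a := 0) (b := L) (e := e) hh.contDiff hh.norm_fderiv_le x
    rw [← hP] at hP'
    rw [← hQ] at hQ'
    rw [(((hΘ'.const_sub 1).fun_mul (hPb.differentiable x).hasFDerivAt).fun_sub
      (hΘ'.fun_mul (hQb.differentiable x).hasFDerivAt)).fderiv]
    have h1 : (1 - θ k (x k)) * h (x + (-L) • e) = 0 := by
      by_cases hx : c k + r ≤ x k
      · simp [(hθ k).eq_one _ hx]
      · rw [hzero _ k, mul_zero]
        rw [he, add_smul_single_self]
        exact lt_abs.2 (Or.inr (by linarith))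
    have h2 : θ k (x k) * h (x + L • e) = 0 := by
      by_cases hx : x k ≤ c k - r
      · simp [(hθ k).eq_zero _ hx]
      · rw [hzero _ k, mul_zero]
        rw [he, add_smul_single_self]
        exact lt_abs.2 (Or.inl (by linarith))
    have hek : e k = 1 := by simp [he]
    simp only [sub_apply, add_apply, smul_apply, neg_apply, smul_eq_mul, hP', hQ',
      PiLp.proj_apply, hek, zero_smul, add_zero]
    linear_combination h1 * (-1) - h2
  · intro hsm
    have hc := hasCompactSupport_of_cube hs
    have hPsm : ContDiff ℝ (⊤ : ℕ∞) P := contDiff_lineInt hsm hc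
    have hQsm : ContDiff ℝ (⊤ : ℕ∞) Q := contDiff_lineInt hsm hc
    exact ⟨((contDiff_const.sub hΘ).mul hPsm).sub (hΘ.mul hQsm), (hη.mul hPsm).add (hη.mul hQsm)⟩
  · have hG : ∀ x, deriv (θ k) (x k) * P x + deriv (θ k) (x k) * Q x
        = deriv (θ k) (x k) * ∫ t : ℝ, h (x + t • e) := fun x => by
      rw [← mul_add, hPQ]
      by_cases hx : r < |x k - c k|
      · simp [(hθ k).deriv_eq_zero hx]
      · rw [lineInt, intervalIntegral.integral_eq_integral_of_support_subset]
        intro t ht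
        have h3 := hs ht k
        rw [he, add_smul_single_self] at h3
        rw [not_lt] at hx
        rw [abs_le] at h3 hx
        constructor <;> linarith [h3.1, h3.2, hx.1, hx.2]
    intro x s
    simp only [hG, ← he]
    have hinv : ∫ t : ℝ, h (x + s • e + t • e) = ∫ t : ℝ, h (x + t • e) := by
      rw [← integral_add_left_eq_self (fun t : ℝ => h (x + t • e)) s]
      simp [add_smul, add_assoc]
    rw [hinv, he, add_smul_single_self]
    ring
  · intro i hik hprof x s
    have hpr : ∀ t : ℝ, h (x + s • EuclideanSpace.single i 1 + t • e) * deriv (θ i) (x i)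
        = h (x + t • e) * deriv (θ i) (x i + s) := fun t => by
      have := hprof (x + t • e) s
      rw [he, add_smul_single_of_ne x hik] at this
      rwa [add_right_comm] at this
    simp only [← mul_add, hPQ, add_smul_single_of_ne x hik.symm]
    rw [mul_assoc, mul_assoc]
    congr 1
    unfold lineInt
    rw [← intervalIntegral.integral_mul_const, ← intervalIntegral.integral_mul_const]
    simp only [hpr]

end Box
section CubeDecomposition

variable {n : ℕ}

theorem HasProfile.mul_prod {η : Fin n → ℝ → ℝ} {p : EuclideanSpace ℝ (Fin n) → ℝ}
    (hp : ∀ i, HasProfile (η i) i p) (x y : EuclideanSpace ℝ (Fin n)) :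
    p x * ∏ i, η i (y i) = p y * ∏ i, η i (x i) := by
  have key : ∀ t : Finset (Fin n),
      p (y + ∑ i ∈ t, (x i - y i) • EuclideanSpace.single i (1 : ℝ)) * ∏ i ∈ t, η i (y i)
        = p y * ∏ i ∈ t, η i (x i) := fun t => by
    induction t using Finset.induction_on with
    | empty => simp
    | insert k t hk ih =>
      have hcoord : (y + ∑ i ∈ t, (x i - y i) • EuclideanSpace.single i (1 : ℝ)) k = y k := by
        have : ∑ i ∈ t, (x i - y i) * (Pi.single i (1 : ℝ) : Fin n → ℝ) k = 0 :=
          Finset.sum_eq_zero fun i hi => by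
            have hki : k ≠ i := fun h => hk (h ▸ hi)
            rw [Pi.single_eq_of_ne hki, mul_zero]
        simpa using this
      have h := hp k (y + ∑ i ∈ t, (x i - y i) • EuclideanSpace.single i (1 : ℝ)) (x k - y k)
      rw [hcoord, add_sub_cancel] at h
      rw [Finset.sum_insert hk, Finset.prod_insert hk, Finset.prod_insert hk,
        add_comm (_ • _) (∑ _ ∈ _, _), ← add_assoc, ← mul_assoc, h]
      linear_combination η k (x k) * ih
  have hx : y + ∑ i, (x i - y i) • EuclideanSpace.single i (1 : ℝ) = x := by
    ext j
    simp [Pi.single_apply]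
  simpa only [hx] using key Finset.univ

theorem exists_iterated_primitive {α : ℝ} (hα : α ∈ Ioo (0 : ℝ) 1)
    (c : EuclideanSpace ℝ (Fin n)) {r : ℝ} (hr : 0 < r) {θ : Fin n → ℝ → ℝ}
    (hθ : ∀ i, IsStep (θ i) (c i) r) (s : Finset (Fin n)) :
    ∃ C, 0 ≤ C ∧ ∀ (M : ℝ) (h : EuclideanSpace ℝ (Fin n) → ℝ), C1Bound α M h →
      support h ⊆ closedCube c r →
      ∃ (v : EuclideanSpace ℝ (Fin n) → EuclideanSpace ℝ (Fin n))
        (p : EuclideanSpace ℝ (Fin n) → ℝ),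
        C1Bound α (C * M) v ∧ C1Bound α (C * M) p ∧
        support v ⊆ closedCube c r ∧ support p ⊆ closedCube c r ∧
        (∀ x, divergence v x = h x - p x) ∧
        (ContDiff ℝ (⊤ : ℕ∞) h → ContDiff ℝ (⊤ : ℕ∞) v ∧ ContDiff ℝ (⊤ : ℕ∞) p) ∧
        ∀ i ∈ s, HasProfile (deriv (θ i)) i p := by
  induction s using Finset.induction_on with
  | empty =>
    refine ⟨1, zero_le_one, fun M h hh hs => ⟨fun _ => 0, h, ?_, by simpa using hh, by simp, hs,
      by simp [divergence], fun hsm => ⟨contDiff_const, hsm⟩, by simp⟩⟩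
    exact C1Bound.zero.mono (by simpa using hh.nonneg)
  | insert k s hk ih =>
    obtain ⟨C, hC, hind⟩ := ih
    obtain ⟨D, hD, hstep⟩ := exists_partial_primitive hα c hr hθ k
    refine ⟨C + D * C, by positivity, fun M h hh hs => ?_⟩
    have hM := hh.nonneg
    obtain ⟨v, p, hv, hp, hvs, hps, hdiv, hsm, hprof⟩ := hind M h hh hs
    obtain ⟨u, q, hu, hq, hus, hqs, hder, hsm', hk', hprof'⟩ := hstep _ p hp hps
    set e : EuclideanSpace ℝ (Fin n) := EuclideanSpace.single k 1 with he
    have hue : C1Bound α (D * (C * M)) (fun x => u x • e) := by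
      refine (hu.clm_comp ((ContinuousLinearMap.id ℝ ℝ).smulRight e)).mono ?_
      have : ‖(ContinuousLinearMap.id ℝ ℝ).smulRight e‖ = 1 := by
        rw [ContinuousLinearMap.norm_smulRight_apply, ContinuousLinearMap.norm_id, he]; simp
      rw [this, one_mul]
    refine ⟨fun x => v x + u x • e, q, (hv.add hue).mono (by linarith),
      hq.mono (by nlinarith [mul_nonneg hC hM]), fun x hx => ?_, hqs, fun x => ?_,
      fun h' => ⟨(hsm h').1.add ((hsm' (hsm h').2).1.smul contDiff_const), (hsm' (hsm h').2).2⟩,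
      fun i hi => ?_⟩
    · by_contra hx'
      exact hx (by
        simp [notMem_support.1 fun h => hx' (hvs h), notMem_support.1 fun h => hx' (hus h)])
    · rw [divergence_add hv.differentiable hue.differentiable,
        divergence_smul_const hu.differentiable, hdiv, hder]
      ring
    · rcases Finset.mem_insert.1 hi with rfl | hi
      · exact hk'
      · exact hprof' i (fun h => hk (h ▸ hi)) (hprof i hi)

theorem integral_eq_of_divergence_eq {v : EuclideanSpace ℝ (Fin n) → EuclideanSpace ℝ (Fin n)}
    {h p : EuclideanSpace ℝ (Fin n) → ℝ} (hv : ContDiff ℝ 1 v) (hvc : HasCompactSupport v)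
    (hh : Integrable h) (hp : Integrable p) (hdiv : ∀ x, divergence v x = h x - p x) :
    ∫ x, h x = ∫ x, p x := by
  have := integral_divergence_eq_zero hv hvc
  simp_rw [hdiv] at this
  rw [integral_sub hh hp] at this
  linarith

/-- A function supported in a cube is the divergence of a field supported in the same cube, up
to a multiple of a fixed bump function; the field is as regular as the function. -/
theorem exists_cube_decomposition {α : ℝ} (hα : α ∈ Ioo (0 : ℝ) 1)
    (c : EuclideanSpace ℝ (Fin n)) {r : ℝ} (hr : 0 < r) :
    ∃ ρ : EuclideanSpace ℝ (Fin n) → ℝ, ContDiff ℝ (⊤ : ℕ∞) ρ ∧ support ρ ⊆ closedCube c r ∧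
      ∃ C, 0 ≤ C ∧ ∀ (M : ℝ) (h : EuclideanSpace ℝ (Fin n) → ℝ), C1Bound α M h →
        support h ⊆ closedCube c r →
        ∃ v : EuclideanSpace ℝ (Fin n) → EuclideanSpace ℝ (Fin n),
          C1Bound α (C * M) v ∧ support v ⊆ closedCube c r ∧
          (∀ x, divergence v x = h x - (∫ y, h y) * ρ x) ∧
          (ContDiff ℝ (⊤ : ℕ∞) h → ContDiff ℝ (⊤ : ℕ∞) v) := by
  choose θ hθ using fun i => exists_isStep (c i) hr
  obtain ⟨C, hC, hdec⟩ := exists_iterated_primitive hα c hr hθ Finset.univ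
  choose y hy using fun i => (hθ i).exists_deriv_ne_zero
  have hY : ∏ i, deriv (θ i) (y i) ≠ 0 := Finset.prod_ne_zero_iff.2 fun i _ => hy i
  have hnhds : closedCube c r ∈ 𝓝 c := by
    have : ∀ i, ∀ᶠ x : EuclideanSpace ℝ (Fin n) in 𝓝 c, |x i - c i| ≤ r := fun i => by
      have hcont : Continuous fun x : EuclideanSpace ℝ (Fin n) => |x i - c i| := by fun_prop
      exact (hcont.tendsto c).eventually (ge_mem_nhds (by simpa using hr))
    exact eventually_all.2 this
  obtain ⟨b, hbs, hbc, hb, hb01, hb1⟩ := exists_contDiff_tsupport_subset (n := ⊤) hnhds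
  have hbs' : support b ⊆ closedCube c r := (subset_tsupport b).trans hbs
  obtain ⟨N, hN⟩ := hbc.exists_c1Bound hα (mod_cast contDiff_infty.1 hb 2)
  obtain ⟨w, q, hw, hq, hws, hqs, hwdiv, hwsm, hqprof⟩ := hdec N b hN hbs'
  have hInt : ∀ {f : EuclideanSpace ℝ (Fin n) → ℝ} {K : ℝ}, C1Bound α K f →
      support f ⊆ closedCube c r → Integrable f := fun hf hs =>
    hf.contDiff.continuous.integrable_of_hasCompactSupport (hasCompactSupport_of_cube hs)
  have hpos : 0 < ∫ x, b x := by
    refine hb.continuous.integral_pos_of_hasCompactSupport_nonneg_nonzero hbc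
      (fun x => (hb01 ⟨x, rfl⟩).1) (x := c) (by rw [hb1]; exact one_ne_zero)
  have hbq : ∫ x, b x = ∫ x, q x :=
    integral_eq_of_divergence_eq hw.contDiff (hasCompactSupport_of_cube hws) (hInt hN hbs')
      (hInt hq hqs) hwdiv
  refine ⟨fun x => (∫ z, b z)⁻¹ * q x, contDiff_const.mul (hwsm hb).2,
    (support_mul_subset_right _ _).trans hqs, C, hC, fun M h hh hs => ?_⟩
  obtain ⟨v, p, hv, hp, hvs, hps, hdiv, hsm, hprof⟩ := hdec M h hh hs
  refine ⟨v, hv, hvs, fun x => ?_, fun h' => (hsm h').1⟩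
  have hhp : ∫ x, h x = ∫ x, p x :=
    integral_eq_of_divergence_eq hv.contDiff (hasCompactSupport_of_cube hvs) (hInt hh hs)
      (hInt hp hps) hdiv
  set Y : EuclideanSpace ℝ (Fin n) := WithLp.toLp 2 y with hYdef
  have hform : ∀ {f : EuclideanSpace ℝ (Fin n) → ℝ},
      (∀ i ∈ Finset.univ, HasProfile (deriv (θ i)) i f) →
      ∀ x, f x = (f Y * (∏ i, deriv (θ i) (y i))⁻¹) * ∏ i, deriv (θ i) (x i) := fun hf x => by
    have := HasProfile.mul_prod (fun i => hf i (Finset.mem_univ i)) x Y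
    simp only [hYdef] at this ⊢
    field_simp
    linarith
  have hpx := hform hprof
  have hqx := hform hqprof
  have hIp : ∫ x, p x = (p Y * (∏ i, deriv (θ i) (y i))⁻¹) *
      ∫ x : EuclideanSpace ℝ (Fin n), ∏ i, deriv (θ i) (x i) := by
    rw [← integral_const_mul]; exact integral_congr_ae (Eventually.of_forall hpx)
  have hIq : ∫ x, q x = (q Y * (∏ i, deriv (θ i) (y i))⁻¹) *
      ∫ x : EuclideanSpace ℝ (Fin n), ∏ i, deriv (θ i) (x i) := by
    rw [← integral_const_mul]; exact integral_congr_ae (Eventually.of_forall hqx)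
  rw [hdiv, hhp]
  congr 1
  have hne : ∫ x, q x ≠ 0 := hbq ▸ hpos.ne'
  rw [hbq]
  field_simp
  rw [hIp, hIq, hpx x, hqx x]
  ring

end CubeDecomposition

section Flux

variable {n : ℕ}

theorem isPreconnected_norm_gt (hn : 2 ≤ n) {R : ℝ} (hR : 0 ≤ R) :
    IsPreconnected {x : EuclideanSpace ℝ (Fin n) | R < ‖x‖} := by
  have hrank : 1 < Module.rank ℝ (EuclideanSpace ℝ (Fin n)) := by
    rw [← Module.finrank_eq_rank, finrank_euclideanSpace_fin]
    exact_mod_cast hn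
  have hc := (isConnected_compl_singleton_of_one_lt_rank hrank 0).isPreconnected
  have himg : {x : EuclideanSpace ℝ (Fin n) | R < ‖x‖}
      = (fun x => (1 + R / ‖x‖) • x) '' {0}ᶜ := by
    ext x
    constructor
    · intro hx
      have hx : R < ‖x‖ := hx
      have hx0 : 0 < ‖x‖ := hR.trans_lt hx
      have h1 : 0 < 1 - R / ‖x‖ := by rw [sub_pos, div_lt_one hx0]; exact hx
      refine ⟨(1 - R / ‖x‖) • x, ?_, ?_⟩
      · simp [h1.ne', norm_pos_iff.1 hx0]
      · have h2 : ‖x‖ - R ≠ 0 := (sub_pos.2 hx).ne'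
        simp only [norm_smul, Real.norm_eq_abs, abs_of_pos h1, smul_smul]
        convert one_smul ℝ x using 2
        field_simp
        ring
    · rintro ⟨y, hy, rfl⟩
      have hy0 : 0 < ‖y‖ := norm_pos_iff.2 hy
      have h1 : 0 < 1 + R / ‖y‖ := by positivity
      simp only [mem_ofPred_eq, norm_smul, Real.norm_eq_abs, abs_of_pos h1]
      field_simp
      linarith
  rw [himg]
  refine hc.image _ (ContinuousOn.smul (continuousOn_const.add (continuousOn_const.div
    continuous_norm.continuousOn fun x hx => (norm_pos_iff.2 hx).ne')) continuousOn_id)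

/-- A compactly supported closed `1`-form annihilates divergence-free fields. -/
theorem integral_closedForm_eq_zero (hn : 2 ≤ n)
    {ω : EuclideanSpace ℝ (Fin n) → EuclideanSpace ℝ (Fin n) →L[ℝ] ℝ} (hω : ContDiff ℝ 1 ω)
    (hc : HasCompactSupport ω)
    (hsymm : ∀ x a b, fderiv ℝ ω x a b = fderiv ℝ ω x b a)
    {D : EuclideanSpace ℝ (Fin n) → EuclideanSpace ℝ (Fin n)} (hD : ContDiff ℝ 1 D)
    (hdiv : ∀ x, divergence D x = 0) : ∫ x, ω x (D x) = 0 := by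
  obtain ⟨f, hf⟩ := convex_univ.exists_forall_hasFDerivAt_of_fderiv_symmetric isOpen_univ
    (hω.differentiable one_ne_zero).differentiableOn fun x _ => hsymm x
  replace hf : ∀ x, HasFDerivAt f (ω x) x := fun x => hf x trivial
  obtain ⟨R, hR0, hR⟩ := hc.isCompact.isBounded.exists_pos_norm_le
  have hout : ∀ x, R < ‖x‖ → ω x = 0 := fun x hx =>
    image_eq_zero_of_notMem_tsupport fun h => absurd (hR x h) (not_le.2 hx)
  obtain ⟨a, ha⟩ := (isOpen_lt continuous_const continuous_norm).exists_is_const_of_fderiv_eq_zero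
    (isPreconnected_norm_gt hn hR0.le)
    (fun x _ => (hf x).differentiableAt.differentiableWithinAt)
    (fun x hx => by rw [(hf x).fderiv, hout x hx]; rfl)
  set g : EuclideanSpace ℝ (Fin n) → ℝ := fun x => f x - a with hg
  have hg' : ∀ x, HasFDerivAt g (ω x) x := fun x => (hf x).sub_const a
  have hfd : fderiv ℝ g = ω := funext fun x => (hg' x).fderiv
  have hgd : Differentiable ℝ g := fun x => (hg' x).differentiableAt
  have hg1 : ContDiff ℝ 1 g := contDiff_one_iff_fderiv.2 ⟨hgd, hfd ▸ hω.continuous⟩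
  have hgc : HasCompactSupport fun x => g x • D x :=
    HasCompactSupport.intro (isCompact_closedBall 0 R) fun x hx => by
      simp [hg, ha x (by simpa using hx)]
  have : ∫ x, divergence (fun y => g y • D y) x = 0 :=
    integral_divergence_eq_zero (hg1.smul hD) hgc
  simpa only [divergence_smul hgd (hD.differentiable one_ne_zero), hdiv, mul_zero, add_zero, hfd]
    using this

end Flux

theorem LinearMap.exists_bounded_preimage {E F : Type*} [NormedAddCommGroup E] [NormedSpace ℝ E]
    [NormedAddCommGroup F] [NormedSpace ℝ F] [FiniteDimensional ℝ F] (f : E →ₗ[ℝ] F) :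
    ∃ C, 0 ≤ C ∧ ∀ m ∈ LinearMap.range f, ∃ c, f c = m ∧ ‖c‖ ≤ C * ‖m‖ := by
  obtain ⟨g, hg⟩ := f.rangeRestrict.exists_rightInverse_of_surjective f.range_rangeRestrict
  set G : LinearMap.range f →L[ℝ] E := LinearMap.toContinuousLinearMap g
  refine ⟨‖G‖, G.opNorm_nonneg, fun m hm => ⟨G ⟨m, hm⟩, ?_, G.le_opNorm ⟨m, hm⟩⟩⟩
  exact congrArg Subtype.val (LinearMap.congr_fun hg ⟨m, hm⟩)

section Gluing

variable {n : ℕ}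

/-- On functions supported in `B`, the divergence has a bounded right inverse up to multiples of
`ρ`. -/
structure DivergenceKernel (α C : ℝ) (B : Set (EuclideanSpace ℝ (Fin n)))
    (ρ : EuclideanSpace ℝ (Fin n) → ℝ) : Prop where
  nonneg : 0 ≤ C
  isCompact : IsCompact B
  exists_field : ∀ (M : ℝ) (h : EuclideanSpace ℝ (Fin n) → ℝ), C1Bound α M h → support h ⊆ B →
    ∃ v : EuclideanSpace ℝ (Fin n) → EuclideanSpace ℝ (Fin n),
      C1Bound α (C * M) v ∧ support v ⊆ B ∧
      (∀ x, divergence v x = h x - (∫ y, h y) * ρ x) ∧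
      (ContDiff ℝ (⊤ : ℕ∞) h → ContDiff ℝ (⊤ : ℕ∞) v)

theorem DivergenceKernel.exists_transfer {α C₁ C₂ : ℝ} (hα : α ∈ Ioo (0 : ℝ) 1)
    {B₁ B₂ : Set (EuclideanSpace ℝ (Fin n))} {ρ₁ ρ₂ : EuclideanSpace ℝ (Fin n) → ℝ}
    (h₁ : DivergenceKernel α C₁ B₁ ρ₁) (h₂ : DivergenceKernel α C₂ B₂ ρ₂)
    {x : EuclideanSpace ℝ (Fin n)} (hx : B₁ ∩ B₂ ∈ 𝓝 x) :
    ∃ w : EuclideanSpace ℝ (Fin n) → EuclideanSpace ℝ (Fin n), ContDiff ℝ (⊤ : ℕ∞) w ∧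
      support w ⊆ B₁ ∪ B₂ ∧ ∀ x, divergence w x = ρ₁ x - ρ₂ x := by
  obtain ⟨b, hbs, hbc, hb, hb01, hb1⟩ := exists_contDiff_tsupport_subset (n := ⊤) hx
  have hbs' : support b ⊆ B₁ ∩ B₂ := (subset_tsupport b).trans hbs
  obtain ⟨N, hN⟩ := hbc.exists_c1Bound hα (mod_cast contDiff_infty.1 hb 2)
  have hpos : 0 < ∫ x, b x :=
    hb.continuous.integral_pos_of_hasCompactSupport_nonneg_nonzero hbc
      (fun x => (hb01 ⟨x, rfl⟩).1) (x := x) (by rw [hb1]; exact one_ne_zero)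
  obtain ⟨v₁, hv₁, hs₁, hd₁, hc₁⟩ :=
    h₁.exists_field N b hN (hbs'.trans inter_subset_left)
  obtain ⟨v₂, hv₂, hs₂, hd₂, hc₂⟩ :=
    h₂.exists_field N b hN (hbs'.trans inter_subset_right)
  refine ⟨fun x => (∫ y, b y)⁻¹ • (v₂ x - v₁ x), contDiff_const.fun_smul ((hc₂ hb).sub (hc₁ hb)),
    fun y hy => ?_, fun y => ?_⟩
  · by_contra hy'
    rw [mem_union, not_or] at hy'
    exact hy (by
      simp [notMem_support.1 fun h => hy'.1 (hs₁ h), notMem_support.1 fun h => hy'.2 (hs₂ h)])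
  · rw [divergence_const_smul _ (hv₂.differentiable.fun_sub hv₁.differentiable),
      divergence_sub hv₂.differentiable hv₁.differentiable, hd₁, hd₂]
    field_simp
    ring

theorem exists_eventuallyEq_smul_fderiv {ι : Type*} [Fintype ι]
    {φ : EuclideanSpace ℝ (Fin n) → ℝ} {χ : ι → EuclideanSpace ℝ (Fin n) → ℝ}
    (hsum : ∀ x ∈ tsupport (fderiv ℝ φ), ∑ i, χ i x = 1) {l : ι → ℝ}
    (hl : ∀ i j x, x ∈ tsupport (χ i) → x ∈ tsupport (χ j) → l i = l j)
    (x : EuclideanSpace ℝ (Fin n)) :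
    ∃ a : ℝ, (fun y => (∑ i, l i * χ i y) • fderiv ℝ φ y) =ᶠ[𝓝 x]
      fun y => a • fderiv ℝ φ y := by
  by_cases hx : ∃ i, x ∈ tsupport (χ i)
  · obtain ⟨i, hi⟩ := hx
    refine ⟨l i, ?_⟩
    have hev : ∀ j, ∀ᶠ y in 𝓝 x, l j * χ j y = l i * χ j y := fun j => by
      by_cases hj : x ∈ tsupport (χ j)
      · exact Eventually.of_forall fun y => by rw [hl j i x hj hi]
      · filter_upwards [(isClosed_tsupport _).isOpen_compl.mem_nhds hj] with y hy
        rw [image_eq_zero_of_notMem_tsupport hy, mul_zero, mul_zero]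
    filter_upwards [eventually_all.2 hev] with y hy
    simp_rw [hy, ← Finset.mul_sum]
    by_cases hy' : y ∈ tsupport (fderiv ℝ φ)
    · rw [hsum y hy', mul_one]
    · simp [image_eq_zero_of_notMem_tsupport hy']
  · have hx' : x ∉ tsupport (fderiv ℝ φ) := fun h => by
      push Not at hx
      simpa [fun i => image_eq_zero_of_notMem_tsupport (hx i)] using hsum x h
    refine ⟨0, ?_⟩
    filter_upwards [(isClosed_tsupport _).isOpen_compl.mem_nhds hx'] with y hy
    simp [image_eq_zero_of_notMem_tsupport hy]

theorem fderiv_symm_of_eventuallyEq {φ : EuclideanSpace ℝ (Fin n) → ℝ}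
    (hφ : ContDiff ℝ (⊤ : ℕ∞) φ)
    {ω : EuclideanSpace ℝ (Fin n) → EuclideanSpace ℝ (Fin n) →L[ℝ] ℝ}
    {x : EuclideanSpace ℝ (Fin n)} {a : ℝ} (h : ω =ᶠ[𝓝 x] fun y => a • fderiv ℝ φ y)
    (u v : EuclideanSpace ℝ (Fin n)) : fderiv ℝ ω x u v = fderiv ℝ ω x v u := by
  have h2 : ContDiff ℝ 2 φ := mod_cast contDiff_infty.1 hφ 2
  have hd : Differentiable ℝ (fderiv ℝ φ) :=
    (h2.fderiv_right (m := 1) (by norm_num)).differentiable one_ne_zero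
  have hs : IsSymmSndFDerivAt ℝ φ x := h2.contDiffAt.isSymmSndFDerivAt (by simp)
  rw [h.fderiv_eq, fderiv_fun_const_smul (hd x)]
  simp [hs.eq u v]

theorem integral_weighted_flux_eq_zero (hn : 2 ≤ n) {ι : Type*} [Fintype ι]
    {φ : EuclideanSpace ℝ (Fin n) → ℝ} (hφ : ContDiff ℝ (⊤ : ℕ∞) φ) (hφc : HasCompactSupport φ)
    {χ : ι → EuclideanSpace ℝ (Fin n) → ℝ} (hχ : ∀ i, ContDiff ℝ (⊤ : ℕ∞) (χ i))
    (hsum : ∀ x ∈ tsupport (fderiv ℝ φ), ∑ i, χ i x = 1) {l : ι → ℝ}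
    (hl : ∀ i j x, x ∈ tsupport (χ i) → x ∈ tsupport (χ j) → l i = l j)
    {D : EuclideanSpace ℝ (Fin n) → EuclideanSpace ℝ (Fin n)} (hD : ContDiff ℝ 1 D)
    (hdiv : ∀ x, divergence D x = 0) :
    ∑ i, l i * ∫ x, χ i x * fderiv ℝ φ x (D x) = 0 := by
  have h2 : ContDiff ℝ 2 φ := mod_cast contDiff_infty.1 hφ 2
  have hφ' : ContDiff ℝ 1 (fderiv ℝ φ) := h2.fderiv_right (by norm_num)
  have hχ1 : ∀ i, ContDiff ℝ 1 (χ i) := fun i => mod_cast contDiff_infty.1 (hχ i) 1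
  have hω : ContDiff ℝ 1 fun y => (∑ i, l i * χ i y) • fderiv ℝ φ y :=
    ContDiff.fun_smul (ContDiff.sum fun i _ => contDiff_const.mul (hχ1 i)) hφ'
  have hωc : HasCompactSupport fun y => (∑ i, l i * χ i y) • fderiv ℝ φ y :=
    HasCompactSupport.intro (hφc.fderiv ℝ).isCompact fun x hx => by
      rw [image_eq_zero_of_notMem_tsupport hx, smul_zero]
  have h0 := integral_closedForm_eq_zero hn hω hωc (fun x u v => by
    obtain ⟨a, ha⟩ := exists_eventuallyEq_smul_fderiv hsum hl x
    exact fderiv_symm_of_eventuallyEq hφ ha u v) hD hdiv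
  have hInt : ∀ i, Integrable fun x => l i * (χ i x * fderiv ℝ φ x (D x)) := fun i => by
    refine (Continuous.integrable_of_hasCompactSupport ?_ ?_).const_mul _
    · exact (hχ i).continuous.mul (hφ'.continuous.clm_apply hD.continuous)
    · refine HasCompactSupport.intro (hφc.fderiv ℝ).isCompact fun x hx => ?_
      simp [image_eq_zero_of_notMem_tsupport hx]
  simp_rw [← integral_const_mul]
  rw [← integral_finsetSum _ fun i _ => hInt i, ← h0]
  refine integral_congr_ae (Eventually.of_forall fun x => ?_)
  simp [Finset.sum_mul, mul_assoc]

theorem DivergenceKernel.exists_transfer_family {ι : Type*} [Fintype ι] [DecidableEq ι]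
    {α : ℝ} (hα : α ∈ Ioo (0 : ℝ) 1)
    {Ω B : ι → Set (EuclideanSpace ℝ (Fin n))} (hΩ : ∀ i, IsOpen (Ω i)) (hΩB : ∀ i, Ω i ⊆ B i)
    {C : ι → ℝ} {ρ : ι → EuclideanSpace ℝ (Fin n) → ℝ}
    (hker : ∀ i, DivergenceKernel α (C i) (B i) (ρ i)) :
    ∃ (u : ι × ι → ι → ℝ) (w : ι × ι → EuclideanSpace ℝ (Fin n) → EuclideanSpace ℝ (Fin n)),
      (∀ i j, (Ω i ∩ Ω j).Nonempty → u (i, j) = Pi.single i 1 - Pi.single j 1) ∧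
      ∀ p, ContDiff ℝ (⊤ : ℕ∞) (w p) ∧ support (w p) ⊆ ⋃ i, B i ∧
        ∀ x, divergence (w p) x = ∑ i, u p i * ρ i x := by
  have h : ∀ p : ι × ι, ∃ (u : ι → ℝ) (w : EuclideanSpace ℝ (Fin n) → EuclideanSpace ℝ (Fin n)),
      ((Ω p.1 ∩ Ω p.2).Nonempty → u = Pi.single p.1 1 - Pi.single p.2 1) ∧
      ContDiff ℝ (⊤ : ℕ∞) w ∧ support w ⊆ ⋃ i, B i ∧
        ∀ x, divergence w x = ∑ i, u i * ρ i x := fun p => by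
    by_cases hp : (Ω p.1 ∩ Ω p.2).Nonempty
    · obtain ⟨x, hx⟩ := hp
      obtain ⟨w, hw, hws, hwd⟩ := (hker p.1).exists_transfer hα (hker p.2)
        (mem_of_superset (((hΩ p.1).inter (hΩ p.2)).mem_nhds hx)
          (inter_subset_inter (hΩB p.1) (hΩB p.2)))
      refine ⟨_, w, fun _ => rfl, hw, hws.trans (union_subset (subset_iUnion B p.1)
        (subset_iUnion B p.2)), fun y => ?_⟩
      simp [hwd, sub_mul, Pi.single_apply, Finset.sum_sub_distrib]
    · exact ⟨0, fun _ => 0, fun h => absurd h hp, contDiff_const, by simp, by simp [divergence]⟩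
  choose u w hu hw using h
  exact ⟨u, w, fun i j => hu (i, j), hw⟩

/-- Bounded solution operator for `div v = dφ(D)` with `D` divergence-free, the field `v` being
supported in a given finite cover of the support of `dφ`. -/
theorem DivergenceKernel.exists_div_eq_of_cover (hn : 2 ≤ n) {ι : Type} [Fintype ι] {α : ℝ}
    (hα : α ∈ Ioo (0 : ℝ) 1) {Ω B : ι → Set (EuclideanSpace ℝ (Fin n))}
    (hΩ : ∀ i, IsOpen (Ω i)) (hΩB : ∀ i, Ω i ⊆ B i) {C : ι → ℝ}
    {ρ : ι → EuclideanSpace ℝ (Fin n) → ℝ} (hker : ∀ i, DivergenceKernel α (C i) (B i) (ρ i))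
    {φ : EuclideanSpace ℝ (Fin n) → ℝ} (hφ : ContDiff ℝ (⊤ : ℕ∞) φ) (hφc : HasCompactSupport φ)
    (hcov : tsupport (fderiv ℝ φ) ⊆ ⋃ i, Ω i) :
    ∃ A, 0 ≤ A ∧ ∀ D : EuclideanSpace ℝ (Fin n) → EuclideanSpace ℝ (Fin n), ContDiff ℝ 1 D →
      (∀ x, divergence D x = 0) → ∀ M, C1Bound α M (fun x => fderiv ℝ φ x (D x)) →
      ∃ v : EuclideanSpace ℝ (Fin n) → EuclideanSpace ℝ (Fin n), C1Bound α (A * M) v ∧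
        support v ⊆ ⋃ i, B i ∧ (∀ x, divergence v x = fderiv ℝ φ x (D x)) ∧
        (ContDiff ℝ (⊤ : ℕ∞) (fun x => fderiv ℝ φ x (D x)) → ContDiff ℝ (⊤ : ℕ∞) v) := by
  classical
  obtain ⟨P, hP⟩ := SmoothPartitionOfUnity.exists_isSubordinate
    (modelWithCornersSelf ℝ (EuclideanSpace ℝ (Fin n))) (isClosed_tsupport (fderiv ℝ φ)) Ω hΩ hcov
  set χ : ι → EuclideanSpace ℝ (Fin n) → ℝ := fun i => P i with hχdef
  have hχ : ∀ i, ContDiff ℝ (⊤ : ℕ∞) (χ i) := fun i => (P i).contMDiff.contDiff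
  have hsum : ∀ x ∈ tsupport (fderiv ℝ φ), ∑ i, χ i x = 1 := fun x hx => by
    rw [← P.sum_eq_one hx, finsum_eq_sum_of_fintype]
  have hχs : ∀ i, tsupport (χ i) ⊆ Ω i := hP
  obtain ⟨u, w, hu, hw⟩ := DivergenceKernel.exists_transfer_family hα hΩ hΩB hker
  have hT : IsCompact (⋃ i, B i) := isCompact_iUnion fun i => (hker i).isCompact
  have hwN : ∀ p, ∃ N, C1Bound α N (w p) := fun p =>
    (HasCompactSupport.intro hT fun x hx => notMem_support.1 fun h =>
      hx ((hw p).2.1 h)).exists_c1Bound hα (mod_cast contDiff_infty.1 (hw p).1 2)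
  choose N hN using hwN
  choose A hA hχA using fun i => exists_c1Bound_mul hα (hχ i) (hφc.fderiv ℝ).isCompact
  obtain ⟨L, hL, hpre⟩ := (Fintype.linearCombination ℝ u).exists_bounded_preimage
  set Q : ℝ := ∑ i, A i * volume.real (B i) with hQ
  have hQ0 : 0 ≤ Q := Finset.sum_nonneg fun i _ => mul_nonneg (hA i) measureReal_nonneg
  refine ⟨∑ i, C i * A i + L * Q * ∑ p, N p, ?_, fun D hD hdiv M hM => ?_⟩
  · exact add_nonneg (Finset.sum_nonneg fun i _ => mul_nonneg (hker i).nonneg (hA i))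
      (mul_nonneg (mul_nonneg hL hQ0) (Finset.sum_nonneg fun p _ => (hN p).nonneg))
  set g : EuclideanSpace ℝ (Fin n) → ℝ := fun x => fderiv ℝ φ x (D x) with hg
  have hgs : support g ⊆ tsupport (fderiv ℝ φ) := fun x hx => by
    by_contra hx'
    exact hx (by simp [hg, image_eq_zero_of_notMem_tsupport hx'])
  have hχg : ∀ i, C1Bound α (A i * M) fun x => χ i x * g x := fun i => hχA i M g hM hgs
  have hχgs : ∀ i, support (fun x => χ i x * g x) ⊆ B i := fun i =>
    (support_mul_subset_left _ _).trans ((subset_tsupport _).trans ((hχs i).trans (hΩB i)))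
  set m : ι → ℝ := fun i => ∫ x, χ i x * g x with hm
  have hmi : ∀ i, |m i| ≤ A i * volume.real (B i) * M := fun i => by
    rw [hm, ← Real.norm_eq_abs]
    dsimp only
    rw [← setIntegral_eq_integral_of_forall_compl_eq_zero (s := B i) fun x hx =>
      notMem_support.1 fun h => hx (hχgs i h)]
    refine (norm_setIntegral_le_of_norm_le_const (hker i).isCompact.measure_lt_top
      fun x _ => (hχg i).norm_le x).trans_eq (by ring)
  have hmQ : ‖m‖ ≤ Q * M := by
    refine (pi_norm_le_iff_of_nonneg (mul_nonneg hQ0 hM.nonneg)).2 fun i => (hmi i).trans ?_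
    refine mul_le_mul_of_nonneg_right ?_ hM.nonneg
    exact Finset.single_le_sum (f := fun i => A i * volume.real (B i))
      (fun i _ => mul_nonneg (hA i) measureReal_nonneg) (Finset.mem_univ i)
  have hmem : m ∈ LinearMap.range (Fintype.linearCombination ℝ u) := by
    by_contra hnot
    obtain ⟨Λ, hΛm, hΛ⟩ := Submodule.exists_le_ker_of_notMem hnot
    refine hΛm ?_
    rw [LinearMap.pi_apply_eq_sum_univ Λ m]
    have := integral_weighted_flux_eq_zero hn hφ hφc hχ hsum
      (l := fun i => Λ fun j => if i = j then 1 else 0) (fun i j x hi hj => ?_) hD hdiv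
    · refine Eq.trans ?_ this
      exact Finset.sum_congr rfl fun i _ => mul_comm _ _
    · have hker' : Λ (u (i, j)) = 0 := hΛ ⟨Pi.single (i, j) 1, by simp⟩
      rw [hu i j ⟨x, hχs i hi, hχs j hj⟩, map_sub, sub_eq_zero] at hker'
      convert hker' using 2 <;> · ext k; simp [Pi.single_apply, eq_comm]
  obtain ⟨c, hcm, hcL⟩ := hpre m hmem
  choose V hV hVs hVd hVc using fun i => (hker i).exists_field _ _ (hχg i) (hχgs i)
  have hVd' : Differentiable ℝ fun x => ∑ i, V i x :=
    Differentiable.fun_sum fun i _ => (hV i).differentiable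
  have hWd : ∀ p ∈ Finset.univ, Differentiable ℝ fun x => c p • w p x := fun p _ =>
    (hN p).differentiable.const_smul (c p)
  refine ⟨fun x => ∑ i, V i x + ∑ p, c p • w p x, ?_, fun x hx => ?_, fun x => ?_, fun hsm => ?_⟩
  · refine ((C1Bound.sum Finset.univ fun i _ => hV i).add
      (C1Bound.sum Finset.univ fun p _ => (hN p).const_smul (c p))).mono ?_
    have h1 : ∑ p, |c p| * N p ≤ L * (Q * M) * ∑ p, N p := by
      rw [Finset.mul_sum]
      refine Finset.sum_le_sum fun p _ => mul_le_mul_of_nonneg_right ?_ (hN p).nonneg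
      exact (norm_le_pi_norm c p).trans (hcL.trans (mul_le_mul_of_nonneg_left hmQ hL))
    have h2 : ∑ i, C i * (A i * M) = (∑ i, C i * A i) * M := by
      rw [Finset.sum_mul]
      exact Finset.sum_congr rfl fun i _ => by ring
    rw [h2]
    linarith
  · by_contra hx'
    refine hx ?_
    have h1 : ∀ i, V i x = 0 := fun i => notMem_support.1 fun h =>
      hx' (mem_iUnion.2 ⟨i, hVs i h⟩)
    have h2 : ∀ p, w p x = 0 := fun p => notMem_support.1 fun h => hx' ((hw p).2.1 h)
    simp [h1, h2]
  · rw [divergence_add hVd' (Differentiable.fun_sum hWd),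
      divergence_sum _ fun i _ => (hV i).differentiable, divergence_sum _ hWd]
    simp_rw [fun p => divergence_const_smul (c p) (hN p).differentiable x, hVd, (hw _).2.2,
      Finset.mul_sum]
    rw [Finset.sum_comm, Finset.sum_sub_distrib, ← Finset.sum_mul]
    have h1 : ∀ i, ∑ p, c p * (u p i * ρ i x) = m i * ρ i x := fun i => by
      rw [← hcm, Fintype.linearCombination_apply, Finset.sum_apply, Finset.sum_mul]
      exact Finset.sum_congr rfl fun p _ => by simp [mul_assoc]
    simp_rw [h1]
    rw [sub_add_cancel]
    by_cases hx : x ∈ tsupport (fderiv ℝ φ)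
    · rw [hsum x hx, one_mul]
    · simp [hg, image_eq_zero_of_notMem_tsupport hx]
  · exact (ContDiff.sum fun i _ => hVc i ((hχ i).mul hsm)).add
      (ContDiff.sum fun p _ => contDiff_const.fun_smul (hw p).1)

end Gluing

section Pasting

variable {n : ℕ}

theorem isOpen_openCube (c : EuclideanSpace ℝ (Fin n)) (r : ℝ) :
    IsOpen {x : EuclideanSpace ℝ (Fin n) | ∀ i, |x i - c i| < r} := by
  simp only [ofPred_forall]
  exact isOpen_iInter_of_finite fun i => isOpen_lt (by fun_prop) continuous_const

theorem exists_closedCube_subset {O : Set (EuclideanSpace ℝ (Fin n))} (hO : IsOpen O)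
    {x : EuclideanSpace ℝ (Fin n)} (hx : x ∈ O) : ∃ r > 0, closedCube x r ⊆ O := by
  obtain ⟨ε, hε, hb⟩ := Metric.isOpen_iff.1 hO x hx
  have hn1 : (0 : ℝ) < n + 1 := by positivity
  refine ⟨ε / (n + 1), by positivity, fun y hy => hb ?_⟩
  set r := ε / (n + 1) with hr
  have hr0 : 0 < r := by positivity
  have hrε : r * (n + 1) = ε := div_mul_cancel₀ _ hn1.ne'
  rw [Metric.mem_ball, EuclideanSpace.dist_eq, Real.sqrt_lt' hε]
  have h1 : ∑ i, dist (y i) (x i) ^ 2 ≤ ∑ _i : Fin n, r ^ 2 :=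
    Finset.sum_le_sum fun i _ => pow_le_pow_left₀ dist_nonneg (by rw [Real.dist_eq]; exact hy i) 2
  rw [Finset.sum_const, Finset.card_univ, Fintype.card_fin, nsmul_eq_mul] at h1
  refine h1.trans_lt ?_
  rw [← hrε, mul_pow, mul_comm]
  refine mul_lt_mul_of_pos_left ?_ (by positivity)
  nlinarith [(Nat.cast_nonneg n : (0 : ℝ) ≤ n)]

/-- Bounded solution operator for `div v = dφ(D)` with `D` divergence-free, the field `v` being
supported in a given neighbourhood of the support of `dφ`. -/
theorem exists_div_eq_fderiv_apply (hn : 2 ≤ n) {α : ℝ} (hα : α ∈ Ioo (0 : ℝ) 1)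
    {φ : EuclideanSpace ℝ (Fin n) → ℝ} (hφ : ContDiff ℝ (⊤ : ℕ∞) φ) (hφc : HasCompactSupport φ)
    {O : Set (EuclideanSpace ℝ (Fin n))} (hO : IsOpen O) (hφO : tsupport (fderiv ℝ φ) ⊆ O) :
    ∃ A, 0 ≤ A ∧ ∀ D : EuclideanSpace ℝ (Fin n) → EuclideanSpace ℝ (Fin n), ContDiff ℝ 1 D →
      (∀ x, divergence D x = 0) → ∀ M, C1Bound α M (fun x => fderiv ℝ φ x (D x)) →
      ∃ v : EuclideanSpace ℝ (Fin n) → EuclideanSpace ℝ (Fin n), C1Bound α (A * M) v ∧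
        support v ⊆ O ∧ (∀ x, divergence v x = fderiv ℝ φ x (D x)) ∧
        (ContDiff ℝ (⊤ : ℕ∞) (fun x => fderiv ℝ φ x (D x)) → ContDiff ℝ (⊤ : ℕ∞) v) := by
  choose r hr hrO using fun x : tsupport (fderiv ℝ φ) =>
    exists_closedCube_subset hO (hφO x.2)
  set Ω : tsupport (fderiv ℝ φ) → Set (EuclideanSpace ℝ (Fin n)) := fun c =>
    {x | ∀ i, |x i - (c : EuclideanSpace ℝ (Fin n)) i| < r c} with hΩdef
  have hΩ : ∀ c, IsOpen (Ω c) := fun c => isOpen_openCube _ _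
  obtain ⟨t, ht⟩ := (hφc.fderiv ℝ).isCompact.elim_finite_subcover Ω hΩ fun x hx =>
    mem_iUnion.2 ⟨⟨x, hx⟩, fun i => by simpa using hr ⟨x, hx⟩⟩
  choose ρ _ _ C hC hdec using fun c : tsupport (fderiv ℝ φ) =>
    exists_cube_decomposition hα (c : EuclideanSpace ℝ (Fin n)) (hr c)
  obtain ⟨A, hA, hsolve⟩ := DivergenceKernel.exists_div_eq_of_cover hn hα (ι := t)
    (Ω := fun c => Ω c) (B := fun c => closedCube c (r c)) (C := fun c => C c) (ρ := fun c => ρ c)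
    (fun c => hΩ c) (fun c x hx i => (hx i).le)
    (fun c => ⟨hC c, isCompact_closedCube _ _, hdec c⟩) hφ hφc
    (ht.trans (iUnion₂_subset fun c hc => subset_iUnion (fun c : t => Ω c) ⟨c, hc⟩))
  refine ⟨A, hA, fun D hD hdiv M hM => ?_⟩
  obtain ⟨v, hv, hvs, hvd, hvc⟩ := hsolve D hD hdiv M hM
  exact ⟨v, hv, hvs.trans (iUnion_subset fun c => hrO c), hvd, hvc⟩

theorem exists_smooth_cutoff {K K' : Set (EuclideanSpace ℝ (Fin n))} (hK : IsCompact K)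
    (hK' : IsCompact K') (h : K ⊆ interior K') :
    ∃ φ : EuclideanSpace ℝ (Fin n) → ℝ, ContDiff ℝ (⊤ : ℕ∞) φ ∧ HasCompactSupport φ ∧
      tsupport φ ⊆ K' ∧ ∀ᶠ x in 𝓝ˢ K, φ x = 1 := by
  obtain ⟨φ, h1, h0, -⟩ := exists_contMDiffMap_one_nhds_of_subset_interior (n := (⊤ : ℕ∞))
    (modelWithCornersSelf ℝ (EuclideanSpace ℝ (Fin n))) hK.isClosed h
  exact ⟨φ, φ.contMDiff.contDiff, HasCompactSupport.intro hK' h0,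
    closure_minimal (fun x hx => by_contra fun hx' => hx (h0 x hx')) hK'.isClosed, h1⟩

/-- The difference of two `C¹`-close divergence-free fields can be cut off outside a neighbourhood
of a compact set, within divergence-free fields and with control of the `C¹` norm. -/
theorem exists_divFree_cutoff (hn : 2 ≤ n) {α : ℝ} (hα : α ∈ Ioo (0 : ℝ) 1)
    {K U : Set (EuclideanSpace ℝ (Fin n))} (hK : IsCompact K) (hU : IsOpen U) (hKU : K ⊆ U) :
    ∃ V, IsOpen V ∧ K ⊆ V ∧ V ⊆ U ∧ ∃ Q, 0 ≤ Q ∧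
      ∀ D : EuclideanSpace ℝ (Fin n) → EuclideanSpace ℝ (Fin n), C1Holder α D →
        (∀ x, divergence D x = 0) → ∀ δ, 0 ≤ δ → (∀ x ∈ U, ‖D x‖ ≤ δ) →
        (∀ x ∈ U, ‖fderiv ℝ D x‖ ≤ δ) →
        ∃ e : EuclideanSpace ℝ (Fin n) → EuclideanSpace ℝ (Fin n), C1Bound α (Q * δ) e ∧
          (∀ x, divergence e x = 0) ∧ (∀ x ∈ V, e x = D x) ∧ (∀ x ∉ U, e x = 0) ∧
          (ContDiff ℝ (⊤ : ℕ∞) D → ContDiff ℝ (⊤ : ℕ∞) e) := by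
  obtain ⟨K₀, hK₀, hKK₀, hK₀U⟩ := exists_compact_between hK hU hKU
  obtain ⟨K₁, hK₁, hK₀₁, hK₁U⟩ := exists_compact_between hK₀ hU hK₀U
  obtain ⟨K₂, hK₂, hK₁₂, hK₂U⟩ := exists_compact_between hK₁ hU hK₁U
  obtain ⟨φ, hφ, hφc, hφs, hφ1⟩ := exists_smooth_cutoff hK₀ hK₁ hK₀₁
  obtain ⟨ψ, hψ, hψc, hψs, hψ1⟩ := exists_smooth_cutoff hK₁ hK₂ hK₁₂
  have hφ2 : ContDiff ℝ 2 φ := mod_cast contDiff_infty.1 hφ 2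
  have hφ3 : ContDiff ℝ 3 φ := mod_cast contDiff_infty.1 hφ 3
  have hdφs : tsupport (fderiv ℝ φ) ⊆ U \ K₀ := fun x hx => by
    refine ⟨hK₁U (hφs (tsupport_fderiv_subset ℝ hx)), fun hx₀ => ?_⟩
    refine notMem_tsupport_iff_eventuallyEq.2 ?_ hx
    have : φ =ᶠ[𝓝 x] fun _ => 1 := eventually_nhdsSet_iff_forall.1 hφ1 x hx₀
    filter_upwards [this.fderiv (𝕜 := ℝ)] with y hy
    simp [hy]
  obtain ⟨A, hA, hsolve⟩ :=
    exists_div_eq_fderiv_apply hn hα hφ hφc (hU.sdiff hK₀.isClosed) hdφs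
  obtain ⟨N, hN⟩ := hφc.exists_c1Bound hα hφ2
  obtain ⟨N', hN'⟩ := (hφc.fderiv ℝ).exists_c1Bound hα (hφ3.fderiv_right (by norm_num))
  obtain ⟨P, hP⟩ := hψc.exists_c1Bound hα (mod_cast contDiff_infty.1 hψ 2)
  have hN0 := hN.nonneg
  have hN'0 := hN'.nonneg
  have hP0 := hP.nonneg
  set B := ContinuousLinearMap.id ℝ (EuclideanSpace ℝ (Fin n) →L[ℝ] ℝ) with hB
  refine ⟨interior K₀, isOpen_interior, hKK₀, interior_subset.trans hK₀U,
    2 * N + A * (2 * ‖B‖ * N' * (2 * P)), by positivity, fun D hD hdiv δ hδ hDδ hDδ' => ?_⟩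
  obtain ⟨hD1, C, -, hC⟩ := hD
  have hφD : C1Bound α (2 * N * δ) fun x => φ x • D x :=
    hN.smul_of_tsupport hα hφc hD1 hC hδ (fun x hx => hDδ x (hK₁U (hφs hx)))
      fun x hx => hDδ' x (hK₁U (hφs hx))
  have hψD : C1Bound α (2 * P * δ) fun x => ψ x • D x :=
    hP.smul_of_tsupport hα hψc hD1 hC hδ (fun x hx => hDδ x (hK₂U (hψs hx)))
      fun x hx => hDδ' x (hK₂U (hψs hx))
  have hg : C1Bound α (2 * ‖B‖ * N' * (2 * P * δ)) fun x => fderiv ℝ φ x (D x) := by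
    convert C1Bound.bilin hα B hN' hψD using 2 with x
    by_cases hx : x ∈ tsupport (fderiv ℝ φ)
    · have : ψ x = 1 := hψ1.self_of_nhdsSet x (hφs (tsupport_fderiv_subset ℝ hx))
      simp [hB, this]
    · simp [hB, image_eq_zero_of_notMem_tsupport hx]
  obtain ⟨v, hv, hvs, hvd, hvc⟩ := hsolve D hD1 hdiv _ hg
  have hv0 : ∀ x, x ∉ U \ K₀ → v x = 0 := fun x hx => notMem_support.1 fun h => hx (hvs h)
  refine ⟨fun x => φ x • D x - v x, (hφD.sub hv).mono (le_of_eq (by ring)), fun x => ?_,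
    fun x hx => ?_, fun x hx => ?_, fun hDsm => ?_⟩
  · rw [divergence_sub hφD.differentiable hv.differentiable,
      divergence_smul hN.differentiable (hD1.differentiable one_ne_zero), hdiv, hvd]
    simp
  · have hx₀ : x ∈ K₀ := interior_subset hx
    simp [hv0 x fun h => h.2 hx₀, hφ1.self_of_nhdsSet x hx₀]
  · simp [hv0 x fun h => hx h.1, image_eq_zero_of_notMem_tsupport fun h => hx (hK₁U (hφs h))]
  · exact (hφ.fun_smul hDsm).sub
      (hvc ((hφ.fderiv_right (m := (⊤ : ℕ∞)) (by simp)).clm_apply hDsm))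

end Pasting

/-- The C^{1+α} pasting lemma for divergence-free vector fields. -/
theorem pasting_lemma_C1alpha (n : ℕ) (hn : 2 ≤ n) (α : ℝ) (hα : α ∈ Set.Ioo (0:ℝ) 1)
    (K : Set (EuclideanSpace ℝ (Fin n))) (hK : IsCompact K)
    (U : Set (EuclideanSpace ℝ (Fin n))) (hU : IsOpen U) (hUb : Bornology.IsBounded U)
    (hKU : K ⊆ U) (ε₀ : ℝ) (hε₀ : 0 < ε₀) :
    ∃ δ₀ > (0:ℝ), ∃ V W : Set (EuclideanSpace ℝ (Fin n)),
      IsOpen V ∧ IsOpen W ∧ Bornology.IsBounded W ∧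
      K ⊆ V ∧ V ⊆ U ∧ U ⊆ W ∧
      ∀ X₀ Y₀ : EuclideanSpace ℝ (Fin n) → EuclideanSpace ℝ (Fin n),
        C1Holder α X₀ → DivFree X₀ → C1Holder α Y₀ → DivFree Y₀ →
        (∀ x ∈ U, ‖X₀ x - Y₀ x‖ + ‖fderiv ℝ X₀ x - fderiv ℝ Y₀ x‖ < δ₀) →
        ∃ Z₀ : EuclideanSpace ℝ (Fin n) → EuclideanSpace ℝ (Fin n),
          C1Holder α Z₀ ∧ DivFree Z₀ ∧
          (∀ x ∈ V, Z₀ x = Y₀ x) ∧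
          (∀ x ∉ W, Z₀ x = X₀ x) ∧
          (∀ x, ‖Z₀ x - X₀ x‖ + ‖fderiv ℝ Z₀ x - fderiv ℝ X₀ x‖ < ε₀) ∧
          (ContDiff ℝ (⊤ : ℕ∞) X₀ → ContDiff ℝ (⊤ : ℕ∞) Y₀ → ContDiff ℝ (⊤ : ℕ∞) Z₀) := by
  obtain ⟨V, hV, hKV, hVU, Q, hQ, hcut⟩ := exists_divFree_cutoff hn hα hK hU hKU
  have hδ : 0 < ε₀ / (2 * Q + 1) := by positivity
  refine ⟨ε₀ / (2 * Q + 1), hδ, V, U, hV, hU, hUb, hKV, hVU, subset_rfl, ?_⟩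
  rintro X₀ Y₀ ⟨hX, CX, hCX, hXh⟩ hX0 ⟨hY, CY, hCY, hYh⟩ hY0 hXY
  have hXd := hX.differentiable one_ne_zero
  have hYd := hY.differentiable one_ne_zero
  have hfd : ∀ x, fderiv ℝ (fun x => X₀ x - Y₀ x) x = fderiv ℝ X₀ x - fderiv ℝ Y₀ x :=
    fun x => fderiv_fun_sub (hXd x) (hYd x)
  obtain ⟨e, he, hediv, heV, heU, hesm⟩ := hcut (fun x => X₀ x - Y₀ x)
    ⟨hX.sub hY, CX + CY, by positivity, fun x y => by
      rw [hfd, hfd, sub_sub_sub_comm, add_mul]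
      exact (norm_sub_le _ _).trans (add_le_add (hXh x y) (hYh x y))⟩
    (fun x => by rw [divergence_sub hXd hYd]; exact sub_eq_zero.2 ((hX0 x).trans (hY0 x).symm))
    _ hδ.le (fun x hx => by linarith [hXY x hx, norm_nonneg (fderiv ℝ X₀ x - fderiv ℝ Y₀ x)])
    (fun x hx => by rw [hfd]; linarith [hXY x hx, norm_nonneg (X₀ x - Y₀ x)])
  have hZd : ∀ x, fderiv ℝ (fun x => X₀ x - e x) x = fderiv ℝ X₀ x - fderiv ℝ e x :=
    fun x => fderiv_fun_sub (hXd x) (he.differentiable x)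
  obtain ⟨C, hC, -, hCe⟩ := he.holder
  refine ⟨fun x => X₀ x - e x, ⟨hX.sub he.contDiff, CX + C, by positivity, fun x y => ?_⟩,
    fun x => ?_, fun x hx => ?_, fun x hx => ?_, fun x => ?_,
    fun hXs hYs => hXs.sub (hesm (hXs.sub hYs))⟩
  · rw [hZd, hZd, sub_sub_sub_comm, add_mul]
    exact (norm_sub_le _ _).trans (add_le_add (hXh x y) (hCe x trivial y trivial))
  · refine (divergence_sub hXd he.differentiable x).trans ?_
    rw [hediv, sub_zero]
    exact hX0 x
  · simp [heV x hx]
  · simp [heU x hx]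
  · rw [hZd, sub_sub_cancel_left, sub_sub_cancel_left, norm_neg, norm_neg]
    refine (add_le_add (he.norm_le x) (he.norm_fderiv_le x)).trans_lt ?_
    have : ε₀ / (2 * Q + 1) * (2 * Q + 1) = ε₀ := div_mul_cancel₀ _ (by positivity)
    linarith
end
end
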